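/- arXiv:1507.04875 — 2 statements merged into one kernel-verified Lean document; each statement's English description precedes it below -/
import Mathlib

section
/- Let (A, χ) be a pair where A is a uniform Q_p-Banach algebra and χ : Z_p× → A× a continuous character with |χ(1+p) - 1| < p^{-1/(p^s(p-1))} for some integer s ≥ 0. Let B be a uniform Q_p-Banach algebra. Then the series f(b) = χ(ω(b)) · Σ_{j≥0} (χ(1+p)-1)^j · binom(log⟨b⟩/log(1+p), j) converges in the completed tensor product A ⊗̂ B for every b in B_s× := Z_p× · (1 + p^{s+1}B°), and defines a continuous group homomorphism B_s× → (A ⊗̂ B)× extending χ on Z_p×. -/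
open scoped Topology

/-!
STATEMENT 2: Let `(A, χ)` be a pair where `A` is a uniform `ℚ_p`-Banach algebra and
`χ : ℤ_p^× → A^×` a continuous character with `|χ(1+p) − 1| < p^{-1/(p^s(p-1))}` for some
integer `s ≥ 0`.  Let `B` be a uniform `ℚ_p`-Banach algebra.  Then the series
`f(b) = χ(ω(b)) · ∑_{j≥0} (χ(1+p)−1)^j · binom(log⟨b⟩/log(1+p), j)`
converges in the completed tensor product `A ⊗̂ B` for every
`b ∈ B_s^× := ℤ_p^× · (1 + p^{s+1}B°)`, and defines a continuous group homomorphism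
`B_s^× → (A ⊗̂ B)^×` extending `χ` on `ℤ_p^×`.

Since Mathlib has no completed tensor products of Banach algebras, we present `C = A ⊗̂ B`
through a pair of isometric `ℚ_p`-algebra embeddings `ιA, ιB` into a uniform Banach algebra
`C` whose product span is dense.  The decomposition `b = ω(b)⟨b⟩` with `ω(b) ∈ μ_{p-1}` and
`⟨b⟩ ∈ 1 + pℤ_p + p^{s+1}B°` is quantified over; the values `F b` are multiplicative on
`B_s^×` (hence land in `C^×`), extend `χ`, are continuous on `B_s^×`, and (convergence in
`A° ⊗̂_{ℤ_p} B°`) have norm `≤ 1`.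
-/

/-- The `p`-adic logarithm series in a `ℚ_p`-Banach algebra. -/
noncomputable def plog (p : ℕ) [Fact p.Prime] (B : Type*) [NormedCommRing B]
    [NormedAlgebra ℚ_[p] B] (x : B) : B :=
  ∑' n : ℕ, ((-1 : ℚ_[p]) ^ (n + 1) * ((n : ℚ_[p]))⁻¹) • (x - 1) ^ n

/-- `binom(x, j) = x(x-1)⋯(x-j+1)/j!` in a `ℚ_p`-Banach algebra. -/
noncomputable def binomCoeff (p : ℕ) [Fact p.Prime] (B : Type*) [NormedCommRing B]
    [NormedAlgebra ℚ_[p] B] (x : B) (j : ℕ) : B :=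
  (((j.factorial : ℚ_[p]))⁻¹) • ∏ i ∈ Finset.range j, (x - (i : B))

/-- The subgroup (as a subset) `B_s^× = ℤ_p^× · (1 + p^{s+1}B°) ⊆ (B°)^×`. -/
def BsSet (p : ℕ) [Fact p.Prime] (s : ℕ) (B : Type*) [NormedCommRing B]
    [NormedAlgebra ℚ_[p] B] : Set B :=
  {x | ∃ (z : ℤ_[p]ˣ) (b₀ : B), ‖b₀‖ ≤ (p : ℝ) ^ (-(s + 1 : ℤ)) ∧
    x = algebraMap ℚ_[p] B (((z : ℤ_[p]) : ℚ_[p])) * (1 + b₀)}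

namespace PadicBanach

open Filter Finset

section Padic

variable {p : ℕ} [Fact p.Prime]

lemma norm_natCast_inv {n : ℕ} (hn : n ≠ 0) :
    ‖(n : ℚ_[p])‖⁻¹ = (p : ℝ) ^ padicValNat p n := by
  rw [Padic.norm_eq_zpow_neg_valuation (by exact_mod_cast hn), Padic.valuation_natCast,
    zpow_neg, inv_inv, zpow_natCast]

lemma norm_natCast_inv_le (n : ℕ) : ‖(n : ℚ_[p])‖⁻¹ ≤ n := by
  rcases eq_or_ne n 0 with rfl | hn
  · simp
  · rw [norm_natCast_inv hn]
    exact_mod_cast Nat.le_of_dvd (Nat.pos_of_ne_zero hn) pow_padicValNat_dvd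

lemma norm_natCast_le_one (n : ℕ) : ‖(n : ℚ_[p])‖ ≤ 1 := by
  simpa using Padic.norm_int_le_one (p := p) n

lemma tendsto_choose_pow_sub_one (j : ℕ) :
    Tendsto (fun n : ℕ => (((p ^ n - 1).choose j : ℕ) : ℚ_[p])) atTop (𝓝 ((-1) ^ j)) := by
  induction j with
  | zero => simp
  | succ j ih =>
    have key : ∀ n : ℕ, (((p ^ n - 1).choose (j + 1) : ℕ) : ℚ_[p]) =
        (p : ℚ_[p]) ^ n * ((j + 1 : ℕ) : ℚ_[p])⁻¹ * (((p ^ n - 1).choose j : ℕ) : ℚ_[p]) -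
          (((p ^ n - 1).choose j : ℕ) : ℚ_[p]) := by
      intro n
      have h1 : p ^ n - 1 + 1 = p ^ n :=
        Nat.sub_add_cancel (Nat.one_le_pow _ _ (Fact.out : p.Prime).pos)
      have h2 := Nat.add_one_mul_choose_eq (p ^ n - 1) j
      rw [h1] at h2
      have h3 := Nat.choose_succ_succ (p ^ n - 1) j
      rw [Nat.succ_eq_add_one, Nat.succ_eq_add_one, h1] at h3
      rw [h3] at h2
      have h4 : (p : ℚ_[p]) ^ n * (((p ^ n - 1).choose j : ℕ) : ℚ_[p]) =
        ((((p ^ n - 1).choose j : ℕ) : ℚ_[p]) + (((p ^ n - 1).choose (j + 1) : ℕ) : ℚ_[p])) *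
          ((j + 1 : ℕ) : ℚ_[p]) := by exact_mod_cast h2
      have h5 : ((j + 1 : ℕ) : ℚ_[p]) ≠ 0 := by exact_mod_cast Nat.succ_ne_zero j
      rw [mul_right_comm, h4, mul_inv_cancel_right₀ h5]
      ring
    simp_rw [key]
    have h0 : Tendsto (fun n : ℕ => (p : ℚ_[p]) ^ n) atTop (𝓝 0) :=
      tendsto_pow_atTop_nhds_zero_of_norm_lt_one Padic.norm_p_lt_one
    have := ((h0.mul_const (((j + 1 : ℕ) : ℚ_[p])⁻¹)).mul ih).sub ih
    convert this using 2
    ring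

end Padic

lemma norm_le_of_hasSum {ι E : Type*} [NormedAddCommGroup E] [IsUltrametricDist E] {f : ι → E}
    {a : E} {c : ℝ} (hc : 0 ≤ c) (hf : ∀ i, ‖f i‖ ≤ c) (h : HasSum f a) : ‖a‖ ≤ c :=
  le_of_tendsto (Tendsto.norm h) (Eventually.of_forall fun _ =>
    IsUltrametricDist.norm_sum_le_of_forall_le_of_nonneg hc fun i _ => hf i)

lemma norm_mul_sub_one_lt {R : Type*} [NormedCommRing R] [IsUltrametricDist R] {u v : R} {r : ℝ}
    (hr : r ≤ 1) (hu : ‖u - 1‖ < r) (hv : ‖v - 1‖ < r) :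
    ‖u * v - 1‖ < r := by
  have : u * v - 1 = (u - 1) * (v - 1) + ((u - 1) + (v - 1)) := by ring
  rw [this]
  refine (IsUltrametricDist.norm_add_le_max _ _).trans_lt (max_lt ?_
    ((IsUltrametricDist.norm_add_le_max _ _).trans_lt (max_lt hu hv)))
  refine (norm_mul_le _ _).trans_lt ?_
  nlinarith [norm_nonneg (u - 1), norm_nonneg (v - 1)]

section Log

variable {p : ℕ} [Fact p.Prime] {B : Type*} [NormedCommRing B] [NormedAlgebra ℚ_[p] B]

lemma norm_algebraMap_padic [NormOneClass B] (x : ℚ_[p]) : ‖algebraMap ℚ_[p] B x‖ = ‖x‖ := by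
  rw [norm_algebraMap, norm_one, mul_one]

lemma norm_plog_term_le [NormOneClass B] (y : B) (n : ℕ) :
    ‖((-1 : ℚ_[p]) ^ (n + 1) * ((n : ℚ_[p]))⁻¹) • y ^ n‖ ≤ n * ‖y‖ ^ n := by
  rw [norm_smul, norm_mul, norm_pow, norm_neg, norm_one, one_pow, one_mul, norm_inv]
  exact mul_le_mul (norm_natCast_inv_le n) (norm_pow_le y n) (norm_nonneg _) (Nat.cast_nonneg n)

lemma summable_natCast_mul_pow {r : ℝ} (h0 : 0 ≤ r) (h1 : r < 1) :
    Summable fun n : ℕ => (n : ℝ) * r ^ n := by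
  simpa using summable_pow_mul_geometric_of_norm_lt_one 1 (r := r)
    (by rwa [Real.norm_of_nonneg h0])

variable [CompleteSpace B] [NormOneClass B]

lemma hasSum_plog {u : B} (hu : ‖u - 1‖ < 1) :
    HasSum (fun n : ℕ => ((-1 : ℚ_[p]) ^ (n + 1) * ((n : ℚ_[p]))⁻¹) • (u - 1) ^ n)
      (plog p B u) :=
  (Summable.of_norm_bounded (summable_natCast_mul_pow (norm_nonneg _) hu)
    (norm_plog_term_le (u - 1))).hasSum

lemma tendsto_plog {u : B} (hu : ‖u - 1‖ < 1) :
    Tendsto (fun n : ℕ => ((p : ℚ_[p]) ^ n)⁻¹ • (u ^ p ^ n - 1)) atTop (𝓝 (plog p B u)) := by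
  set y := u - 1 with hy
  have hp0 : (p : ℚ_[p]) ≠ 0 := by exact_mod_cast (Fact.out : p.Prime).ne_zero
  let c : ℕ → ℕ → ℚ_[p] := fun n k => (k : ℚ_[p])⁻¹ * (((p ^ n - 1).choose (k - 1) : ℕ) : ℚ_[p])
  have hc : ∀ n k : ℕ, c n (k + 1) = ((p : ℚ_[p]) ^ n)⁻¹ * ((p ^ n).choose (k + 1) : ℕ) := by
    intro n k
    have h1 : p ^ n - 1 + 1 = p ^ n :=
      Nat.sub_add_cancel (Nat.one_le_pow _ _ (Fact.out : p.Prime).pos)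
    have h2 := Nat.add_one_mul_choose_eq (p ^ n - 1) k
    rw [h1] at h2
    have h4 : (p : ℚ_[p]) ^ n * (((p ^ n - 1).choose k : ℕ) : ℚ_[p]) =
      (((p ^ n).choose (k + 1) : ℕ) : ℚ_[p]) * ((k + 1 : ℕ) : ℚ_[p]) := by exact_mod_cast h2
    have h5 : ((k + 1 : ℕ) : ℚ_[p]) ≠ 0 := by exact_mod_cast Nat.succ_ne_zero k
    simp only [c, Nat.add_sub_cancel]
    field_simp
    linear_combination h4
  have hsum : ∀ n : ℕ, ((p : ℚ_[p]) ^ n)⁻¹ • (u ^ p ^ n - 1) = ∑' k, c n k • y ^ k := by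
    intro n
    rw [tsum_eq_sum (s := range (p ^ n + 1))]
    · have hu1 : u = y + 1 := by rw [hy]; ring
      rw [hu1, add_pow, sum_range_succ', sum_range_succ']
      simp only [one_pow, mul_one, pow_zero, Nat.choose_zero_right, Nat.cast_one,
        add_sub_cancel_right, smul_sum]
      have : c n 0 = 0 := by simp [c]
      rw [this, zero_smul, add_zero]
      refine sum_congr rfl fun k _ => ?_
      rw [hc, mul_smul, Nat.cast_smul_eq_nsmul, nsmul_eq_mul, mul_comm (y ^ (k + 1))]
    · intro k hk
      rw [mem_range, not_lt] at hk
      obtain ⟨k, rfl⟩ := Nat.exists_eq_succ_of_ne_zero (n := k) (by omega)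
      rw [Nat.succ_eq_add_one, hc, Nat.choose_eq_zero_of_lt (by omega)]
      simp
  simp_rw [hsum]
  refine tendsto_tsum_of_dominated_convergence
    (summable_natCast_mul_pow (norm_nonneg _) hu) (fun k => ?_) (Eventually.of_forall fun n k => ?_)
  · refine Tendsto.smul_const ?_ _
    rcases k with _ | k
    · simp [c]
    · have := (tendsto_choose_pow_sub_one (p := p) k).const_mul (((k + 1 : ℕ) : ℚ_[p])⁻¹)
      convert this using 2
      · simp [c]
      · ring
  · rw [norm_smul, norm_mul, norm_inv]
    refine mul_le_mul ?_ (norm_pow_le y k) (norm_nonneg _) (Nat.cast_nonneg k)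
    exact (mul_le_of_le_one_right (inv_nonneg.2 (norm_nonneg _)) (norm_natCast_le_one _)).trans
      (norm_natCast_inv_le k)

lemma plog_algebraMap {v : ℚ_[p]} (hv : ‖v - 1‖ < 1) :
    plog p B (algebraMap ℚ_[p] B v) = algebraMap ℚ_[p] B (plog p ℚ_[p] v) := by
  have h1 : HasSum _ _ := (hasSum_plog (p := p) hv).map (algebraMap ℚ_[p] B)
    (algebraMapCLM ℚ_[p] B).continuous
  have hv' : ‖algebraMap ℚ_[p] B v - 1‖ < 1 := by
    rwa [← map_one (algebraMap ℚ_[p] B), ← map_sub, norm_algebraMap_padic]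
  refine (hasSum_plog hv').unique ?_
  convert h1 using 2 with n
  simp [Algebra.smul_def]

variable [IsUltrametricDist B]

lemma plog_mul {u v : B} (hu : ‖u - 1‖ < 1) (hv : ‖v - 1‖ < 1) :
    plog p B (u * v) = plog p B u + plog p B v := by
  have hp0 : (p : ℚ_[p]) ≠ 0 := by exact_mod_cast (Fact.out : p.Prime).ne_zero
  have h0 : Tendsto (fun n : ℕ => (p : ℚ_[p]) ^ n) atTop (𝓝 0) :=
    tendsto_pow_atTop_nhds_zero_of_norm_lt_one Padic.norm_p_lt_one
  have hu' := tendsto_plog (p := p) hu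
  have hv' := tendsto_plog (p := p) hv
  have h := (h0.smul (hu'.mul hv')).add (hu'.add hv')
  rw [zero_smul, zero_add] at h
  refine tendsto_nhds_unique (tendsto_plog (norm_mul_sub_one_lt le_rfl hu hv)) (h.congr fun n => ?_)
  rw [smul_mul_smul_comm, smul_smul, ← smul_add, ← mul_assoc,
    mul_inv_cancel₀ (pow_ne_zero n hp0), one_mul, ← smul_add, mul_pow]
  congr 1
  ring

lemma plog_one : plog p B 1 = 0 := by
  have h : ‖(1 : B) - 1‖ < 1 := by simp
  simpa using plog_mul (p := p) h h

lemma plog_pow {u : B} (hu : ‖u - 1‖ < 1) (n : ℕ) :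
    ‖u ^ n - 1‖ < 1 ∧ plog p B (u ^ n) = n • plog p B u := by
  induction n with
  | zero => simp [plog_one]
  | succ n ih =>
    rw [pow_succ, plog_mul ih.1 hu, ih.2, succ_nsmul]
    exact ⟨norm_mul_sub_one_lt le_rfl ih.1 hu, rfl⟩

lemma norm_plog_sub_le (hp : p ≠ 2) {u : B} (hu : ‖u - 1‖ ≤ (p : ℝ)⁻¹) :
    ‖plog p B u - (u - 1)‖ ≤ (p : ℝ)⁻¹ * ‖u - 1‖ := by
  have hp2 : 2 ≤ p := (Fact.out : p.Prime).two_le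
  have hp3 : 3 ≤ p := by omega
  have hpR : (3 : ℝ) ≤ p := by exact_mod_cast hp3
  have hpi : (p : ℝ)⁻¹ < 1 := inv_lt_one_of_one_lt₀ (by linarith)
  have hpp : 0 < (p : ℝ)⁻¹ := by positivity
  have h := (hasSum_plog (p := p) (hu.trans_lt hpi)).sub (hasSum_ite_eq 1 (u - 1))
  refine norm_le_of_hasSum (by positivity) (fun n => ?_) h
  rcases eq_or_ne n 0 with rfl | h0
  · simp; positivity
  rcases eq_or_ne n 1 with rfl | h1
  · simp; positivity
  rw [if_neg h1, sub_zero, norm_smul, norm_mul, norm_pow, norm_neg, norm_one, one_pow, one_mul,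
    norm_inv, norm_natCast_inv h0]
  obtain ⟨m, rfl⟩ : ∃ m, n = m + 2 := ⟨n - 2, by omega⟩
  set v := padicValNat p (m + 2) with hv
  have hvm : v ≤ m := by
    have h3 : 3 ^ v ≤ m + 2 := (Nat.pow_le_pow_left hp3 v).trans
      (Nat.le_of_dvd (by omega) pow_padicValNat_dvd)
    rcases Nat.eq_zero_or_pos v with h | h
    · omega
    · have : ∀ w : ℕ, w + 3 ≤ 3 ^ (w + 1) := by
        intro w
        induction w with
        | zero => norm_num
        | succ w ih => rw [pow_succ]; omega
      have := this (v - 1)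
      rw [Nat.sub_add_cancel h] at this
      omega
  calc (p : ℝ) ^ v * ‖(u - 1) ^ (m + 2)‖
      ≤ (p : ℝ) ^ v * (‖u - 1‖ ^ (m + 1) * ‖u - 1‖) := by
        rw [← pow_succ]; gcongr; exact norm_pow_le _ _
    _ ≤ (p : ℝ) ^ m * (((p : ℝ)⁻¹) ^ (m + 1) * ‖u - 1‖) := by
        gcongr
        linarith
    _ = (p : ℝ)⁻¹ * ‖u - 1‖ := by
        rw [pow_succ, ← mul_assoc, ← mul_assoc, ← mul_pow, mul_inv_cancel₀ (by positivity), one_pow,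
          one_mul]

lemma norm_plog (hp : p ≠ 2) {u : B} (hu : ‖u - 1‖ ≤ (p : ℝ)⁻¹) :
    ‖plog p B u‖ = ‖u - 1‖ := by
  have hpi : (p : ℝ)⁻¹ < 1 :=
    inv_lt_one_of_one_lt₀ (by exact_mod_cast (Fact.out : p.Prime).one_lt)
  have h := norm_plog_sub_le hp hu
  rcases (norm_nonneg (u - 1)).eq_or_lt with h0 | h0
  · rw [← h0, mul_zero] at h
    rw [sub_eq_zero.1 (norm_le_zero_iff.1 h)]
  · have hlt : ‖plog p B u - (u - 1)‖ < ‖u - 1‖ := by nlinarith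
    have := IsUltrametricDist.norm_add_eq_max_of_norm_ne_norm hlt.ne
    rwa [sub_add_cancel, max_eq_right hlt.le] at this

end Log

section Factorial

variable {p : ℕ} [Fact p.Prime]

lemma padicValNat_factorial_succ_div (s j : ℕ) :
    padicValNat p ((j + 1) / p ^ s).factorial =
      padicValNat p (j / p ^ s).factorial + (padicValNat p (j + 1) - s) := by
  have hp : p.Prime := Fact.out
  rw [Nat.succ_div]
  split_ifs with h
  · rw [Nat.factorial_succ, padicValNat.mul (Nat.succ_ne_zero _) (Nat.factorial_ne_zero _),
      add_comm]
    congr 1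
    have hq : j / p ^ s + 1 = (j + 1) / p ^ s := by rw [Nat.succ_div, if_pos h]
    rw [Nat.succ_eq_add_one, hq, padicValNat.div_pow h]
  · have : padicValNat p (j + 1) < s := by
      by_contra hs
      exact h ((padicValNat_dvd_iff_le (Nat.succ_ne_zero j)).2 (not_lt.1 hs))
    rw [add_zero, Nat.sub_eq_zero_of_le this.le, add_zero]

/-- The growth rate `p^{1/(p^s(p-1))}` of the binomial coefficients on `ℤ_p + p^s B°`. -/
noncomputable def binomGrowth (p s : ℕ) : ℝ := (p : ℝ) ^ (1 / ((p : ℝ) ^ s * ((p : ℝ) - 1)))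

lemma one_le_binomGrowth (s : ℕ) : 1 ≤ binomGrowth p s := by
  have hp : (1 : ℝ) < p := by exact_mod_cast (Fact.out : p.Prime).one_lt
  have : 0 < (p : ℝ) - 1 := by linarith
  exact Real.one_le_rpow hp.le (by positivity)

lemma pow_padicValNat_factorial_div_le (s j : ℕ) :
    (p : ℝ) ^ padicValNat p (j / p ^ s).factorial ≤ binomGrowth p s ^ j := by
  have hp : (1 : ℝ) < p := by exact_mod_cast (Fact.out : p.Prime).one_lt
  have hp1 : 0 < (p : ℝ) - 1 := by linarith
  rw [binomGrowth, ← Real.rpow_natCast, ← Real.rpow_mul_natCast (by linarith)]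
  refine Real.rpow_le_rpow_of_exponent_le hp.le ?_
  have h1 : (p - 1) * padicValNat p (j / p ^ s).factorial ≤ j / p ^ s := by
    rw [sub_one_mul_padicValNat_factorial]; exact Nat.sub_le _ _
  have h2 : ((p : ℝ) - 1) * padicValNat p (j / p ^ s).factorial ≤ (j : ℝ) / (p : ℝ) ^ s := by
    have h3 : (((p - 1) * padicValNat p (j / p ^ s).factorial : ℕ) : ℝ) ≤ ((j / p ^ s : ℕ) : ℝ) := by
      exact_mod_cast h1
    rw [Nat.cast_mul, Nat.cast_sub (Fact.out : p.Prime).one_le, Nat.cast_one] at h3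
    exact h3.trans (by exact_mod_cast Nat.cast_div_le (α := ℝ))
  rw [le_div_iff₀ (by positivity)] at h2
  rw [div_mul_eq_mul_div, one_mul, le_div_iff₀ (by positivity)]
  linarith

lemma max_norm_natCast_le (s : ℕ) {n : ℕ} (hn : n ≠ 0) :
    max (((p : ℝ) ^ s)⁻¹) ‖(n : ℚ_[p])‖ ≤ ‖(n : ℚ_[p])‖ * (p : ℝ) ^ (padicValNat p n - s) := by
  have hp : (1 : ℝ) < p := by exact_mod_cast (Fact.out : p.Prime).one_lt
  have hn0 : 0 < ‖(n : ℚ_[p])‖ := norm_pos_iff.2 (by exact_mod_cast hn)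
  refine max_le ?_ (le_mul_of_one_le_right hn0.le (one_le_pow₀ hp.le))
  rw [inv_le_iff_one_le_mul₀ (by positivity), mul_assoc, ← pow_add,
    ← inv_le_iff_one_le_mul₀' hn0, norm_natCast_inv hn]
  exact pow_le_pow_right₀ hp.le (by omega)

end Factorial

section Binom

variable {p : ℕ} [Fact p.Prime] {B : Type*} [NormedCommRing B] [NormedAlgebra ℚ_[p] B]

lemma prod_range_sub_eq_smeval {R : Type*} [CommRing R] (x : R) (j : ℕ) :
    ∏ i ∈ range j, (x - (i : R)) = (descPochhammer ℤ j).smeval x := by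
  induction j with
  | zero => simp
  | succ j ih =>
    rw [prod_range_succ, descPochhammer_succ_right, Polynomial.smeval_mul, ih,
      Polynomial.smeval_sub, Polynomial.smeval_X, Polynomial.smeval_natCast]
    simp

lemma binomCoeff_add (x y : B) (j : ℕ) :
    binomCoeff p B (x + y) j =
      ∑ kl ∈ antidiagonal j, binomCoeff p B x kl.1 * binomCoeff p B y kl.2 := by
  simp only [binomCoeff]
  rw [prod_range_sub_eq_smeval, Ring.descPochhammer_smeval_add j (Commute.all x y), smul_sum]
  refine sum_congr rfl fun kl hkl => ?_
  rw [prod_range_sub_eq_smeval, prod_range_sub_eq_smeval, smul_mul_smul_comm, ← nsmul_eq_mul,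
    ← Nat.cast_smul_eq_nsmul ℚ_[p], smul_smul]
  congr 1
  have h := Nat.choose_mul_factorial_mul_factorial (HasAntidiagonal.antidiagonal.fst_le hkl)
  rw [tsub_eq_of_eq_add_rev (mem_antidiagonal.mp hkl).symm] at h
  have h' : ((j.choose kl.1 : ℕ) : ℚ_[p]) * kl.1.factorial * kl.2.factorial = j.factorial := by
    exact_mod_cast h
  have h1 : (kl.1.factorial : ℚ_[p]) ≠ 0 := by exact_mod_cast Nat.factorial_ne_zero _
  have h2 : (kl.2.factorial : ℚ_[p]) ≠ 0 := by exact_mod_cast Nat.factorial_ne_zero _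
  have h3 : (j.factorial : ℚ_[p]) ≠ 0 := by exact_mod_cast Nat.factorial_ne_zero _
  field_simp
  linear_combination h'

lemma binomCoeff_algebraMap (a : ℤ_[p]) (j : ℕ) :
    binomCoeff p B (algebraMap ℚ_[p] B (a : ℚ_[p])) j =
      algebraMap ℚ_[p] B ((Ring.choose a j : ℤ_[p]) : ℚ_[p]) := by
  have h : (j.factorial : ℤ_[p]) * Ring.choose a j = ∏ i ∈ range j, (a - (i : ℤ_[p])) := by
    rw [prod_range_sub_eq_smeval, Ring.descPochhammer_eq_factorial_smul_choose, nsmul_eq_mul]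
  have h' : (j.factorial : ℚ_[p]) * (Ring.choose a j : ℤ_[p]) =
      ∏ i ∈ range j, ((a : ℚ_[p]) - (i : ℚ_[p])) := by
    have := congrArg (PadicInt.Coe.ringHom (p := p)) h
    rw [map_mul, map_prod, map_natCast] at this
    simp only [map_sub, map_natCast] at this
    exact this
  have h3 : (j.factorial : ℚ_[p]) ≠ 0 := by exact_mod_cast Nat.factorial_ne_zero _
  rw [binomCoeff, (eq_inv_mul_iff_mul_eq₀ h3).2 h', map_mul, map_prod, Algebra.smul_def]
  simp

lemma binomCoeff_natCast (n j : ℕ) : binomCoeff p B (n : B) j = (n.choose j : ℕ) := by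
  have := binomCoeff_algebraMap (B := B) (n : ℤ_[p]) j
  rw [Ring.choose_natCast] at this
  simpa using this

lemma continuous_binomCoeff (j : ℕ) : Continuous fun x : B => binomCoeff p B x j := by
  unfold binomCoeff
  fun_prop

variable [IsUltrametricDist B] [NormOneClass B]

lemma norm_prod_range_sub_le {s : ℕ} {c : B} (hc : ‖c‖ ≤ ((p : ℝ) ^ s)⁻¹) (j : ℕ) :
    ‖∏ i ∈ range j, (c - (i : B))‖ ≤
      ‖(j.factorial : ℚ_[p])‖ * (p : ℝ) ^ padicValNat p (j / p ^ s).factorial := by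
  have hsub : ∀ i : ℕ, ‖c - ((i + 1 : ℕ) : B)‖ ≤
      ‖((i + 1 : ℕ) : ℚ_[p])‖ * (p : ℝ) ^ (padicValNat p (i + 1) - s) := by
    intro i
    refine le_trans ?_ (max_norm_natCast_le s (Nat.succ_ne_zero i))
    have h := IsUltrametricDist.norm_add_le_max c (-((i + 1 : ℕ) : B))
    rw [← sub_eq_add_neg, norm_neg] at h
    refine h.trans (max_le_max hc (le_of_eq ?_))
    rw [← map_natCast (algebraMap ℚ_[p] B), norm_algebraMap_padic]
  have hstep : ∀ i : ℕ, (‖((i + 1 : ℕ) : ℚ_[p])‖ * (p : ℝ) ^ (padicValNat p (i + 1) - s)) *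
      (‖(i.factorial : ℚ_[p])‖ * (p : ℝ) ^ padicValNat p (i / p ^ s).factorial) =
      ‖((i + 1).factorial : ℚ_[p])‖ * (p : ℝ) ^ padicValNat p ((i + 1) / p ^ s).factorial := by
    intro i
    rw [padicValNat_factorial_succ_div, Nat.factorial_succ, Nat.cast_mul, norm_mul, pow_add]
    ring
  have hshift : ∀ j : ℕ, ‖∏ i ∈ range j, (c - ((i + 1 : ℕ) : B))‖ ≤
      ‖(j.factorial : ℚ_[p])‖ * (p : ℝ) ^ padicValNat p (j / p ^ s).factorial := by
    intro j
    induction j with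
    | zero => simp
    | succ j ih =>
      rw [prod_range_succ, mul_comm, ← hstep]
      exact (norm_mul_le _ _).trans (mul_le_mul (hsub j) ih (norm_nonneg _) (by positivity))
  rcases j with _ | j
  · simp
  · rw [prod_range_succ', mul_comm, ← hstep, Nat.cast_zero, sub_zero]
    refine (norm_mul_le _ _).trans (mul_le_mul (hc.trans ?_) (hshift j) (norm_nonneg _)
      (by positivity))
    exact (le_max_left _ _).trans (max_norm_natCast_le s (Nat.succ_ne_zero j))

lemma norm_binomCoeff_le_of_norm_le {s : ℕ} {c : B} (hc : ‖c‖ ≤ ((p : ℝ) ^ s)⁻¹) (j : ℕ) :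
    ‖binomCoeff p B c j‖ ≤ binomGrowth p s ^ j := by
  have hj : 0 < ‖(j.factorial : ℚ_[p])‖ :=
    norm_pos_iff.2 (by exact_mod_cast Nat.factorial_ne_zero j)
  rw [binomCoeff, norm_smul, norm_inv, inv_mul_le_iff₀ hj]
  exact (norm_prod_range_sub_le hc j).trans
    (mul_le_mul_of_nonneg_left (pow_padicValNat_factorial_div_le s j) hj.le)

/-- The subset `ℤ_p + p^s B°` of `B`. -/
def binomDomain (p : ℕ) [Fact p.Prime] (s : ℕ) (B : Type*) [NormedCommRing B]
    [NormedAlgebra ℚ_[p] B] : Set B :=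
  {x | ∃ (a : ℤ_[p]) (c : B), ‖c‖ ≤ ((p : ℝ) ^ s)⁻¹ ∧ x = algebraMap ℚ_[p] B (a : ℚ_[p]) + c}

omit [IsUltrametricDist B] [NormOneClass B] in
lemma algebraMap_mem_binomDomain (s : ℕ) (a : ℤ_[p]) :
    algebraMap ℚ_[p] B (a : ℚ_[p]) ∈ binomDomain p s B :=
  ⟨a, 0, by simp, by simp⟩

/-- **Amice's estimate**, in the form of a uniform growth bound. -/
lemma norm_binomCoeff_le {s : ℕ} {x : B} (hx : x ∈ binomDomain p s B) (j : ℕ) :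
    ‖binomCoeff p B x j‖ ≤ binomGrowth p s ^ j := by
  obtain ⟨a, c, hc, rfl⟩ := hx
  have h1 := one_le_binomGrowth (p := p) s
  rw [binomCoeff_add]
  refine IsUltrametricDist.norm_sum_le_of_forall_le_of_nonneg (by positivity) fun kl hkl => ?_
  refine (norm_mul_le _ _).trans ?_
  rw [binomCoeff_algebraMap, norm_algebraMap_padic, ← one_mul (binomGrowth p s ^ j)]
  refine mul_le_mul (PadicInt.norm_le_one _) ?_ (norm_nonneg _) zero_le_one
  exact (norm_binomCoeff_le_of_norm_le hc _).trans
    (pow_le_pow_right₀ h1 (HasAntidiagonal.antidiagonal.snd_le hkl))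

end Binom

section BinomSeries

variable {p : ℕ} [Fact p.Prime] {B C : Type*} [NormedCommRing B] [NormedAlgebra ℚ_[p] B]
  [NormedCommRing C] [NormedAlgebra ℚ_[p] C]

/-- The binomial series `(1 + τ)^x = ∑ τ^j binom(x, j)`, where `x` is mapped to `C` by `φ`. -/
noncomputable def binomSeries (φ : B →ₐ[ℚ_[p]] C) (τ : C) (x : B) : C :=
  ∑' j : ℕ, τ ^ j * φ (binomCoeff p B x j)

variable {φ : B →ₐ[ℚ_[p]] C} {τ : C} {s : ℕ}

lemma binomSeries_natCast (n : ℕ) : binomSeries φ τ (n : B) = (1 + τ) ^ n := by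
  rw [binomSeries, tsum_eq_sum (s := range (n + 1)), add_comm 1 τ, add_pow]
  · refine sum_congr rfl fun j _ => ?_
    rw [binomCoeff_natCast, map_natCast, one_pow, mul_one]
  · intro j hj
    rw [mem_range, not_lt] at hj
    rw [binomCoeff_natCast, Nat.choose_eq_zero_of_lt (by omega)]
    simp

variable [IsUltrametricDist B] [NormOneClass B] [NormOneClass C]
  (hφ : ∀ b, ‖φ b‖ = ‖b‖) (hτ : ‖τ‖ * binomGrowth p s < 1)

include hφ

lemma norm_binomSeries_term_le {x : B} (hx : x ∈ binomDomain p s B) (j : ℕ) :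
    ‖τ ^ j * φ (binomCoeff p B x j)‖ ≤ (‖τ‖ * binomGrowth p s) ^ j := by
  rw [mul_pow]
  refine (norm_mul_le _ _).trans (mul_le_mul (norm_pow_le _ _) ?_ (norm_nonneg _) (by positivity))
  rw [hφ]
  exact norm_binomCoeff_le hx j

include hτ

omit [NormedAlgebra ℚ_[p] C] [IsUltrametricDist B] [NormOneClass B] [NormOneClass C] hφ in
lemma summable_growth : Summable fun j : ℕ => (‖τ‖ * binomGrowth p s) ^ j :=
  summable_geometric_of_lt_one
    (mul_nonneg (norm_nonneg _) (zero_le_one.trans (one_le_binomGrowth s))) hτ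

variable [CompleteSpace C]

lemma hasSum_binomSeries {x : B} (hx : x ∈ binomDomain p s B) :
    HasSum (fun j : ℕ => τ ^ j * φ (binomCoeff p B x j)) (binomSeries φ τ x) :=
  (Summable.of_norm_bounded (summable_growth hτ) (norm_binomSeries_term_le hφ hx)).hasSum

lemma binomSeries_add {x y : B} (hx : x ∈ binomDomain p s B) (hy : y ∈ binomDomain p s B) :
    binomSeries φ τ (x + y) = binomSeries φ τ x * binomSeries φ τ y := by
  have hx' := Summable.of_nonneg_of_le (fun _ => norm_nonneg _)
    (norm_binomSeries_term_le hφ hx) (summable_growth hτ)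
  have hy' := Summable.of_nonneg_of_le (fun _ => norm_nonneg _)
    (norm_binomSeries_term_le hφ hy) (summable_growth hτ)
  rw [binomSeries, binomSeries, binomSeries,
    tsum_mul_tsum_eq_tsum_sum_antidiagonal_of_summable_norm hx' hy']
  refine tsum_congr fun j => ?_
  rw [binomCoeff_add, map_sum, mul_sum]
  refine sum_congr rfl fun kl hkl => ?_
  rw [← mem_antidiagonal.1 hkl, map_mul, pow_add]
  ring

lemma norm_binomSeries_le [IsUltrametricDist C] {x : B} (hx : x ∈ binomDomain p s B) :
    ‖binomSeries φ τ x‖ ≤ 1 :=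
  norm_le_of_hasSum zero_le_one
    (fun j => (norm_binomSeries_term_le hφ hx j).trans (pow_le_one₀
      (mul_nonneg (norm_nonneg _) (zero_le_one.trans (one_le_binomGrowth s))) hτ.le))
    (hasSum_binomSeries hφ hτ hx)

lemma continuousOn_binomSeries : ContinuousOn (binomSeries φ τ) (binomDomain p s B) := by
  have hφc : Continuous φ := (AddMonoidHomClass.isometry_of_norm φ hφ).continuous
  exact continuousOn_tsum
    (fun j => ((hφc.comp (continuous_binomCoeff j)).const_mul (τ ^ j)).continuousOn)
    (summable_growth hτ) fun j x hx => norm_binomSeries_term_le hφ hx j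

end BinomSeries

section Teichmuller

variable {p : ℕ} [Fact p.Prime]

lemma exists_teichmuller (z : ℤ_[p]ˣ) :
    ∃ ω : ℤ_[p]ˣ, ω ^ (p - 1) = 1 ∧ ‖(z : ℤ_[p]) - ω‖ < 1 := by
  have hp : p.Prime := Fact.out
  have hp1 : p - 1 ≠ 0 := by have := hp.two_le; omega
  let F : Polynomial ℤ_[p] := Polynomial.X ^ (p - 1) - 1
  have hF : ∀ a : ℤ_[p], F.aeval a = a ^ (p - 1) - 1 := fun a => by simp [F]
  have hz1 : ‖(z : ℤ_[p]) ^ (p - 1) - 1‖ < 1 := by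
    rw [← PadicInt.mem_nonunits, ← IsLocalRing.mem_maximalIdeal, ← PadicInt.ker_toZMod,
      RingHom.mem_ker, map_sub, map_pow, map_one, sub_eq_zero]
    exact ZMod.pow_card_sub_one_eq_one ((z.isUnit.map PadicInt.toZMod).ne_zero)
  have hd : ‖F.derivative.aeval (z : ℤ_[p])‖ = 1 := by
    have : F.derivative.aeval (z : ℤ_[p]) = ((p - 1 : ℕ) : ℤ_[p]) * (z : ℤ_[p]) ^ (p - 1 - 1) := by
      simp [F, Polynomial.derivative_X_pow]
    rw [this, norm_mul, norm_pow, PadicInt.norm_units, one_pow, mul_one, PadicInt.norm_def]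
    exact Padic.norm_natCast_p_sub_one (p := p)
  obtain ⟨w, hw0, hwz, -⟩ := hensels_lemma (p := p) (F := F) (a := (z : ℤ_[p]))
    (by rw [hd, hF]; simpa using hz1)
  rw [hF, sub_eq_zero] at hw0
  rw [hd] at hwz
  refine ⟨Units.ofPowEqOne w (p - 1) hw0 hp1, Units.pow_ofPowEqOne _ _, ?_⟩
  rw [norm_sub_rev]
  exact hwz

lemma eq_one_of_pow_eq_one (hp : p ≠ 2) {ω : ℤ_[p]ˣ} (hω : ω ^ (p - 1) = 1)
    (h1 : ‖((ω : ℤ_[p]) : ℚ_[p]) - 1‖ < 1) : ω = 1 := by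
  have hle : ‖((ω : ℤ_[p]) : ℚ_[p]) - 1‖ ≤ (p : ℝ)⁻¹ := by
    have := (Padic.norm_le_pow_iff_norm_lt_pow_add_one (((ω : ℤ_[p]) : ℚ_[p]) - 1) (-1)).2
      (by simpa using h1)
    simpa using this
  have hlog := (plog_pow (p := p) h1 (p - 1)).2
  have hω' : ((ω : ℤ_[p]) : ℚ_[p]) ^ (p - 1) = 1 := by
    simpa using congrArg (fun u : ℤ_[p]ˣ => ((u : ℤ_[p]) : ℚ_[p])) hω
  rw [hω', plog_one, nsmul_eq_mul, eq_comm, mul_eq_zero] at hlog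
  rcases hlog with h | h
  · have h2 := (Fact.out : p.Prime).two_le
    have : p - 1 = 0 := by exact_mod_cast h
    omega
  · have h3 := norm_plog hp hle
    rw [h, norm_zero, eq_comm, norm_eq_zero, sub_eq_zero] at h3
    exact Units.ext (Subtype.ext h3)

end Teichmuller

section OneUnits

variable {p : ℕ} [Fact p.Prime] {B : Type*} [NormedCommRing B] [NormedAlgebra ℚ_[p] B]

/-- The subset `1 + pℤ_p + p^{s+1} B°` of `B`. -/
def oneUnits (p : ℕ) [Fact p.Prime] (s : ℕ) (B : Type*) [NormedCommRing B]
    [NormedAlgebra ℚ_[p] B] : Set B :=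
  {u | ∃ (t : ℤ_[p]) (b₀ : B), ‖b₀‖ ≤ (p : ℝ) ^ (-(s + 1 : ℤ)) ∧
    u = 1 + algebraMap ℚ_[p] B ((p : ℚ_[p]) * (t : ℚ_[p])) + b₀}

/-- The normalized logarithm `log u / log (1 + p)`. -/
noncomputable def logRatio (p : ℕ) [Fact p.Prime] (B : Type*) [NormedCommRing B]
    [NormedAlgebra ℚ_[p] B] (u : B) : B :=
  (plog p ℚ_[p] (1 + (p : ℚ_[p])))⁻¹ • plog p B u

lemma algebraMap_mem_oneUnits (s : ℕ) (t : ℤ_[p]) :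
    algebraMap ℚ_[p] B (1 + p * (t : ℚ_[p])) ∈ oneUnits p s B :=
  ⟨t, 0, by rw [norm_zero]; positivity, by rw [map_add, map_one, add_zero]⟩

lemma inv_p_lt_one : (p : ℝ)⁻¹ < 1 :=
  inv_lt_one_of_one_lt₀ (by exact_mod_cast (Fact.out : p.Prime).one_lt)

lemma zpow_neg_succ_le_inv (s : ℕ) : (p : ℝ) ^ (-(s + 1 : ℤ)) ≤ (p : ℝ)⁻¹ := by
  rw [← zpow_neg_one]
  exact zpow_le_zpow_right₀ (by exact_mod_cast (Fact.out : p.Prime).one_le) (by omega)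

lemma norm_p_mul_le (t : ℤ_[p]) : ‖(p : ℚ_[p]) * (t : ℚ_[p])‖ ≤ (p : ℝ)⁻¹ := by
  rw [norm_mul, Padic.norm_p]
  exact mul_le_of_le_one_right (by positivity) (PadicInt.norm_le_one t)

lemma norm_plog_one_add_p (hp : p ≠ 2) : ‖plog p ℚ_[p] (1 + (p : ℚ_[p]))‖ = (p : ℝ)⁻¹ := by
  rw [norm_plog hp (by simp), add_sub_cancel_left, Padic.norm_p]

lemma plog_one_add_p_ne_zero (hp : p ≠ 2) : plog p ℚ_[p] (1 + (p : ℚ_[p])) ≠ 0 := by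
  rw [← norm_pos_iff, norm_plog_one_add_p hp]
  exact inv_pos.2 (by exact_mod_cast (Fact.out : p.Prime).pos)

lemma exists_eq_one_add_p_mul {v : ℤ_[p]} (hv : ‖v - 1‖ < 1) :
    ∃ t : ℤ_[p], v = 1 + p * t := by
  have h := (PadicInt.norm_lt_one_iff_dvd _).1 hv
  obtain ⟨t, ht⟩ := h
  exact ⟨t, by rw [← ht]; ring⟩

variable [NormOneClass B]

lemma norm_one_add_p_mul (t : ℤ_[p]) : ‖1 + (p : ℚ_[p]) * (t : ℚ_[p])‖ = 1 := by
  have h : ‖(p : ℚ_[p]) * (t : ℚ_[p])‖ < ‖(1 : ℚ_[p])‖ := by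
    rw [norm_one]; exact (norm_p_mul_le t).trans_lt inv_p_lt_one
  rw [IsUltrametricDist.norm_add_eq_max_of_norm_ne_norm h.ne', max_eq_left h.le, norm_one]

omit [NormOneClass B] in
/-- An element of `1 + pℤ_p + p^{s+1}B°` factors as an element of `1 + pℤ_p` times one of
`1 + p^{s+1}B°`. -/
lemma exists_factorization {s : ℕ} {u : B} (hu : u ∈ oneUnits p s B) :
    ∃ (t : ℤ_[p]) (c : B), ‖c‖ ≤ (p : ℝ) ^ (-(s + 1 : ℤ)) ∧
      u = algebraMap ℚ_[p] B (1 + p * (t : ℚ_[p])) * (1 + c) := by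
  obtain ⟨t, b₀, hb, rfl⟩ := hu
  have h0 : 1 + (p : ℚ_[p]) * (t : ℚ_[p]) ≠ 0 := by
    rw [← norm_pos_iff, norm_one_add_p_mul]; exact one_pos
  refine ⟨t, (1 + (p : ℚ_[p]) * (t : ℚ_[p]))⁻¹ • b₀, ?_, ?_⟩
  · rwa [norm_smul, norm_inv, norm_one_add_p_mul, inv_one, one_mul]
  · rw [mul_add, mul_one, mul_smul_comm, ← Algebra.smul_def, inv_smul_smul₀ h0, map_add, map_one]

omit [NormOneClass B] in
lemma mul_mem_oneUnits {s : ℕ} {t : ℤ_[p]} {c : B}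
    (hc : ‖c‖ ≤ (p : ℝ) ^ (-(s + 1 : ℤ))) :
    algebraMap ℚ_[p] B (1 + p * (t : ℚ_[p])) * (1 + c) ∈ oneUnits p s B := by
  refine ⟨t, algebraMap ℚ_[p] B (1 + p * (t : ℚ_[p])) * c, ?_, by rw [map_add, map_one]; ring⟩
  rwa [← Algebra.smul_def, norm_smul, norm_one_add_p_mul, one_mul]

variable [IsUltrametricDist B]

omit [NormOneClass B] in
lemma oneUnits_mul {s : ℕ} {u v : B} (hu : u ∈ oneUnits p s B) (hv : v ∈ oneUnits p s B) :
    u * v ∈ oneUnits p s B := by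
  obtain ⟨t, c, hc, rfl⟩ := exists_factorization hu
  obtain ⟨t', c', hc', rfl⟩ := exists_factorization hv
  have key := mul_mem_oneUnits (B := B) (s := s) (t := t + t' + (p : ℤ_[p]) * t * t')
    (c := c * c' + (c + c')) ?_
  · convert key using 1
    simp only [PadicInt.coe_add, PadicInt.coe_mul, PadicInt.coe_natCast, map_add, map_mul,
      map_one]
    ring
  · refine (IsUltrametricDist.norm_add_le_max _ _).trans (max_le ?_
      ((IsUltrametricDist.norm_add_le_max _ _).trans (max_le hc hc')))
    refine (norm_mul_le _ _).trans ((mul_le_of_le_one_right (norm_nonneg _) ?_).trans hc)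
    exact hc'.trans ((zpow_neg_succ_le_inv s).trans inv_p_lt_one.le)

lemma norm_sub_one_of_mem_oneUnits {s : ℕ} {u : B} (hu : u ∈ oneUnits p s B) :
    ‖u - 1‖ ≤ (p : ℝ)⁻¹ := by
  obtain ⟨t, b₀, hb, rfl⟩ := hu
  rw [add_assoc, add_sub_cancel_left]
  refine (IsUltrametricDist.norm_add_le_max _ _).trans (max_le ?_ (hb.trans (zpow_neg_succ_le_inv s)))
  rw [norm_algebraMap_padic]
  exact norm_p_mul_le t

variable [CompleteSpace B]

lemma logRatio_mul {s : ℕ} {u v : B} (hu : u ∈ oneUnits p s B) (hv : v ∈ oneUnits p s B) :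
    logRatio p B (u * v) = logRatio p B u + logRatio p B v := by
  rw [logRatio, plog_mul ((norm_sub_one_of_mem_oneUnits hu).trans_lt inv_p_lt_one)
    ((norm_sub_one_of_mem_oneUnits hv).trans_lt inv_p_lt_one), smul_add]
  rfl

lemma norm_logRatio (hp : p ≠ 2) {u : B} (hu : ‖u - 1‖ ≤ (p : ℝ)⁻¹) :
    ‖logRatio p B u‖ = p * ‖u - 1‖ := by
  rw [logRatio, norm_smul, norm_inv, norm_plog_one_add_p hp, inv_inv, norm_plog hp hu]

omit [IsUltrametricDist B] in
lemma logRatio_algebraMap {v : ℚ_[p]} (hv : ‖v - 1‖ ≤ (p : ℝ)⁻¹) :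
    logRatio p B (algebraMap ℚ_[p] B v) = algebraMap ℚ_[p] B (logRatio p ℚ_[p] v) := by
  rw [logRatio, logRatio, plog_algebraMap (hv.trans_lt inv_p_lt_one), Algebra.smul_def, smul_eq_mul,
    map_mul]

lemma norm_logRatio_le_one (hp : p ≠ 2) {v : ℚ_[p]} (hv : ‖v - 1‖ ≤ (p : ℝ)⁻¹) :
    ‖logRatio p ℚ_[p] v‖ ≤ 1 := by
  have hp0 : 0 < (p : ℝ) := by exact_mod_cast (Fact.out : p.Prime).pos
  rw [norm_logRatio hp hv, ← mul_inv_cancel₀ hp0.ne']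
  exact mul_le_mul_of_nonneg_left hv hp0.le

lemma logRatio_mem_binomDomain (hp : p ≠ 2) {s : ℕ} {u : B} (hu : u ∈ oneUnits p s B) :
    logRatio p B u ∈ binomDomain p s B := by
  have hp0 : 0 < (p : ℝ) := by exact_mod_cast (Fact.out : p.Prime).pos
  obtain ⟨t, c, hc, rfl⟩ := exists_factorization hu
  have hv : ‖1 + (p : ℚ_[p]) * (t : ℚ_[p]) - 1‖ ≤ (p : ℝ)⁻¹ := by
    rw [add_sub_cancel_left]; exact norm_p_mul_le t
  have hc1 : 1 + c ∈ oneUnits p s B := ⟨0, c, hc, by simp⟩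
  rw [logRatio_mul (algebraMap_mem_oneUnits s t) hc1, logRatio_algebraMap hv]
  refine ⟨⟨_, norm_logRatio_le_one hp hv⟩, _, ?_, rfl⟩
  rw [norm_logRatio hp (norm_sub_one_of_mem_oneUnits hc1), add_sub_cancel_left]
  refine (mul_le_mul_of_nonneg_left hc hp0.le).trans_eq ?_
  rw [zpow_neg, zpow_add_one₀ hp0.ne', zpow_natCast, mul_inv, mul_comm, mul_assoc,
    inv_mul_cancel₀ hp0.ne', mul_one]

omit [IsUltrametricDist B] in
lemma continuousOn_logRatio {r : ℝ} (h0 : 0 ≤ r) (h1 : r < 1) :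
    ContinuousOn (logRatio p B) {u | ‖u - 1‖ ≤ r} := by
  refine ContinuousOn.const_smul (continuousOn_tsum (fun n => ?_) (summable_natCast_mul_pow h0 h1)
    fun n u hu => (norm_plog_term_le (u - 1) n).trans ?_) _
  · fun_prop
  · exact mul_le_mul_of_nonneg_left (pow_le_pow_left₀ (norm_nonneg _) hu n) (Nat.cast_nonneg n)

omit [NormOneClass B] [IsUltrametricDist B] [CompleteSpace B] in
lemma exists_decomposition_of_mem_BsSet {s : ℕ} {b : B} (hb : b ∈ BsSet p s B) :
    ∃ ω : ℤ_[p]ˣ, ω ^ (p - 1) = 1 ∧ ∃ u ∈ oneUnits p s B,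
      b = algebraMap ℚ_[p] B ((ω : ℤ_[p]) : ℚ_[p]) * u := by
  obtain ⟨z, b₀, hb₀, rfl⟩ := hb
  obtain ⟨ω, hω, hzω⟩ := exists_teichmuller z
  have hv : ‖((ω⁻¹ * z : ℤ_[p]ˣ) : ℤ_[p]) - 1‖ < 1 := by
    have : ((ω⁻¹ * z : ℤ_[p]ˣ) : ℤ_[p]) - 1 = ((ω⁻¹ : ℤ_[p]ˣ) : ℤ_[p]) * ((z : ℤ_[p]) - ω) := by
      rw [mul_sub, Units.inv_mul, Units.val_mul]
    rwa [this, norm_mul, PadicInt.norm_units, one_mul]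
  obtain ⟨t, ht⟩ := exists_eq_one_add_p_mul hv
  refine ⟨ω, hω, _, mul_mem_oneUnits (t := t) hb₀, ?_⟩
  have hz : (z : ℤ_[p]) = ω * (1 + p * t) := by
    rw [← ht, Units.val_mul, Units.mul_inv_cancel_left]
  rw [hz, ← mul_assoc, ← map_mul]
  simp

end OneUnits

section Character

variable {p : ℕ} [Fact p.Prime]

lemma norm_inv_sub_one_lt {v : ℤ_[p]ˣ} (hv : ‖(v : ℤ_[p]) - 1‖ < 1) :
    ‖((v⁻¹ : ℤ_[p]ˣ) : ℤ_[p]) - 1‖ < 1 := by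
  have : ((v⁻¹ : ℤ_[p]ˣ) : ℤ_[p]) - 1 = ((v⁻¹ : ℤ_[p]ˣ) : ℤ_[p]) * (1 - v) := by
    rw [mul_sub, Units.inv_mul, mul_one]
  rwa [this, norm_mul, PadicInt.norm_units, one_mul, norm_sub_rev]

lemma unit_mem_oneUnits {B : Type*} [NormedCommRing B] [NormedAlgebra ℚ_[p] B] (s : ℕ)
    {v : ℤ_[p]ˣ} (hv : ‖(v : ℤ_[p]) - 1‖ < 1) :
    algebraMap ℚ_[p] B ((v : ℤ_[p]) : ℚ_[p]) ∈ oneUnits p s B := by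
  obtain ⟨t, ht⟩ := exists_eq_one_add_p_mul hv
  rw [ht]
  simpa using algebraMap_mem_oneUnits (B := B) s t

lemma unit_norm_sub_one_le {v : ℤ_[p]ˣ} (hv : ‖(v : ℤ_[p]) - 1‖ < 1) :
    ‖((v : ℤ_[p]) : ℚ_[p]) - 1‖ ≤ (p : ℝ)⁻¹ :=
  norm_sub_one_of_mem_oneUnits (unit_mem_oneUnits (B := ℚ_[p]) 0 hv)

lemma logRatio_one_add_p_pow (hp : p ≠ 2) (k : ℕ) :
    logRatio p ℚ_[p] ((1 + (p : ℚ_[p])) ^ k) = k := by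
  rw [logRatio, (plog_pow (by rw [add_sub_cancel_left]; exact Padic.norm_p_lt_one) k).2,
    nsmul_eq_mul, smul_eq_mul, mul_left_comm, inv_mul_cancel₀ (plog_one_add_p_ne_zero hp), mul_one]

lemma norm_pow_sub_unit (hp : p ≠ 2) {up1 : ℤ_[p]ˣ}
    (hup1 : ((up1 : ℤ_[p]) : ℚ_[p]) = 1 + (p : ℚ_[p])) {v : ℤ_[p]ˣ}
    (hv : ‖(v : ℤ_[p]) - 1‖ < 1) (k : ℕ) :
    p * ‖((up1 ^ k : ℤ_[p]ˣ) : ℤ_[p]) - v‖ = ‖(k : ℚ_[p]) - logRatio p ℚ_[p] (v : ℤ_[p])‖ := by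
  have hup : ‖(up1 : ℤ_[p]) - 1‖ < 1 := by
    rw [PadicInt.norm_def, PadicInt.coe_sub, hup1, PadicInt.coe_one, add_sub_cancel_left]
    exact Padic.norm_p_lt_one
  have hpow : ‖((up1 ^ k : ℤ_[p]ˣ) : ℤ_[p]) - 1‖ < 1 := by
    induction k with
    | zero => simp
    | succ k ih =>
      rw [pow_succ, Units.val_mul]
      exact norm_mul_sub_one_lt le_rfl ih hup
  have hw : ‖((v⁻¹ * up1 ^ k : ℤ_[p]ˣ) : ℤ_[p]) - 1‖ < 1 := by
    rw [Units.val_mul]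
    exact norm_mul_sub_one_lt le_rfl (norm_inv_sub_one_lt hv) hpow
  have hprod : ((v : ℤ_[p]) : ℚ_[p]) * ((v⁻¹ * up1 ^ k : ℤ_[p]ˣ) : ℤ_[p]) =
      (1 + (p : ℚ_[p])) ^ k := by
    rw [← hup1, ← PadicInt.coe_mul, ← Units.val_mul, mul_inv_cancel_left, Units.val_pow_eq_pow_val,
      PadicInt.coe_pow]
  have hlog := logRatio_mul (B := ℚ_[p]) (unit_mem_oneUnits 0 hv) (unit_mem_oneUnits 0 hw)
  simp only [Algebra.algebraMap_self, RingHom.id_apply] at hlog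
  rw [hprod, logRatio_one_add_p_pow hp] at hlog
  rw [hlog, add_sub_cancel_left, norm_logRatio hp (unit_norm_sub_one_le hw)]
  have : ((up1 ^ k : ℤ_[p]ˣ) : ℤ_[p]) - v =
      (v : ℤ_[p]) * (((v⁻¹ * up1 ^ k : ℤ_[p]ˣ) : ℤ_[p]) - 1) := by
    rw [mul_sub, ← Units.val_mul, mul_inv_cancel_left, mul_one]
  rw [this, norm_mul, PadicInt.norm_units, one_mul, PadicInt.norm_def, PadicInt.coe_sub,
    PadicInt.coe_one]

/-- The binomial series interpolates a continuous character on `1 + pℤ_p`. -/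
lemma binomSeries_logRatio_unit {B C : Type*} [NormedCommRing B] [NormedAlgebra ℚ_[p] B]
    [IsUltrametricDist B] [NormOneClass B] [CompleteSpace B]
    [NormedCommRing C] [NormedAlgebra ℚ_[p] C] [NormOneClass C] [CompleteSpace C]
    {φ : B →ₐ[ℚ_[p]] C} (hφ : ∀ b, ‖φ b‖ = ‖b‖) (hp : p ≠ 2) {s : ℕ}
    (ψ : ℤ_[p]ˣ →* C) (hψ : Continuous ψ) {up1 : ℤ_[p]ˣ}
    (hup1 : ((up1 : ℤ_[p]) : ℚ_[p]) = 1 + (p : ℚ_[p]))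
    (hτ : ‖ψ up1 - 1‖ * binomGrowth p s < 1) {v : ℤ_[p]ˣ} (hv : ‖(v : ℤ_[p]) - 1‖ < 1) :
    binomSeries φ (ψ up1 - 1) (logRatio p B (algebraMap ℚ_[p] B ((v : ℤ_[p]) : ℚ_[p]))) = ψ v := by
  have hv' := unit_norm_sub_one_le hv
  let a : ℤ_[p] := ⟨logRatio p ℚ_[p] (v : ℤ_[p]), norm_logRatio_le_one hp hv'⟩
  obtain ⟨x, hx, hxa⟩ := mem_closure_iff_seq_limit.1 (PadicInt.denseRange_natCast (p := p) a)
  choose k hk using hx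
  obtain rfl : (fun n => (k n : ℤ_[p])) = x := funext hk
  rw [logRatio_algebraMap hv']
  have hcont : Continuous fun y : ℤ_[p] =>
      binomSeries φ (ψ up1 - 1) (algebraMap ℚ_[p] B (y : ℚ_[p])) :=
    (continuousOn_binomSeries hφ hτ).comp_continuous
      ((algebraMapCLM ℚ_[p] B).continuous.comp continuous_subtype_val)
      (algebraMap_mem_binomDomain s)
  have h1 := (hcont.tendsto a).comp hxa
  have h2 : Tendsto (fun n => up1 ^ k n) atTop (𝓝 v) := by
    rw [Units.isOpenEmbedding_val.isInducing.tendsto_nhds_iff, tendsto_iff_norm_sub_tendsto_zero]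
    have hp0 : (p : ℝ) ≠ 0 := by exact_mod_cast (Fact.out : p.Prime).ne_zero
    have h3 := (tendsto_iff_norm_sub_tendsto_zero.1 hxa).const_mul ((p : ℝ)⁻¹)
    rw [mul_zero] at h3
    refine h3.congr fun n => ?_
    rw [inv_mul_eq_iff_eq_mul₀ hp0, Function.comp_apply, norm_pow_sub_unit hp hup1 hv,
      PadicInt.norm_def, PadicInt.coe_sub, PadicInt.coe_natCast]
  refine tendsto_nhds_unique h1 (((hψ.tendsto v).comp h2).congr fun n => ?_)
  simp only [Function.comp_apply, PadicInt.coe_natCast, map_natCast, binomSeries_natCast, map_pow]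
  rw [add_sub_cancel]

lemma eq_of_norm_sub_lt_one {B : Type*} [NormedCommRing B] [NormedAlgebra ℚ_[p] B]
    [IsUltrametricDist B] [NormOneClass B] (hp : p ≠ 2) {s : ℕ} {ω ω' : ℤ_[p]ˣ}
    (hω : ω ^ (p - 1) = 1) (hω' : ω' ^ (p - 1) = 1) {u u' : B} (hu : u ∈ oneUnits p s B)
    (hu' : u' ∈ oneUnits p s B)
    (h : ‖algebraMap ℚ_[p] B ((ω : ℤ_[p]) : ℚ_[p]) * u -
      algebraMap ℚ_[p] B ((ω' : ℤ_[p]) : ℚ_[p]) * u'‖ < 1) : ω = ω' := by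
  have hmul : ∀ (z : ℤ_[p]ˣ) (b : B), ‖algebraMap ℚ_[p] B ((z : ℤ_[p]) : ℚ_[p]) * b‖ = ‖b‖ := by
    intro z b
    rw [← Algebra.smul_def, norm_smul, ← PadicInt.norm_def, PadicInt.norm_units, one_mul]
  have h1 : ‖algebraMap ℚ_[p] B (((ω : ℤ_[p]) : ℚ_[p]) - ((ω' : ℤ_[p]) : ℚ_[p]))‖ < 1 := by
    have : algebraMap ℚ_[p] B (((ω : ℤ_[p]) : ℚ_[p]) - ((ω' : ℤ_[p]) : ℚ_[p])) =
        (algebraMap ℚ_[p] B ((ω : ℤ_[p]) : ℚ_[p]) * u -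
          algebraMap ℚ_[p] B ((ω' : ℤ_[p]) : ℚ_[p]) * u') +
        (-(algebraMap ℚ_[p] B ((ω : ℤ_[p]) : ℚ_[p]) * (u - 1)) +
          algebraMap ℚ_[p] B ((ω' : ℤ_[p]) : ℚ_[p]) * (u' - 1)) := by
      rw [map_sub]; ring
    rw [this]
    refine (IsUltrametricDist.norm_add_le_max _ _).trans_lt (max_lt h
      ((IsUltrametricDist.norm_add_le_max _ _).trans_lt (max_lt ?_ ?_)))
    · rw [norm_neg, hmul]
      exact (norm_sub_one_of_mem_oneUnits hu).trans_lt inv_p_lt_one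
    · rw [hmul]
      exact (norm_sub_one_of_mem_oneUnits hu').trans_lt inv_p_lt_one
  rw [norm_algebraMap_padic, ← PadicInt.coe_sub, ← PadicInt.norm_def] at h1
  rw [← inv_mul_eq_one.trans eq_comm]
  refine eq_one_of_pow_eq_one hp (by rw [mul_pow, inv_pow, hω, hω', inv_one, one_mul]) ?_
  rw [← PadicInt.coe_one, ← PadicInt.coe_sub, ← PadicInt.norm_def]
  have : ((ω'⁻¹ * ω : ℤ_[p]ˣ) : ℤ_[p]) - 1 = ((ω'⁻¹ : ℤ_[p]ˣ) : ℤ_[p]) * ((ω : ℤ_[p]) - ω') := by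
    rw [mul_sub, Units.inv_mul, Units.val_mul]
  rwa [this, norm_mul, PadicInt.norm_units, one_mul]

end Character

end PadicBanach

theorem character_extension_to_banach_units
    (p : ℕ) [Fact p.Prime] (hp : p ≠ 2) (s : ℕ)
    (A : Type*) [NormedCommRing A] [NormedAlgebra ℚ_[p] A] [CompleteSpace A]
    [IsUltrametricDist A] (huA : ∀ (x : A) (n : ℕ), ‖x ^ n‖ = ‖x‖ ^ n)
    (B : Type*) [NormedCommRing B] [NormedAlgebra ℚ_[p] B] [CompleteSpace B]
    [IsUltrametricDist B] (huB : ∀ (x : B) (n : ℕ), ‖x ^ n‖ = ‖x‖ ^ n)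
    -- the continuous character `χ` and the norm condition `|χ(1+p) − 1| < p^{-1/(p^s(p-1))}`:
    (χ : ℤ_[p]ˣ →* Aˣ) (hχcont : Continuous fun z : ℤ_[p]ˣ => ((χ z : Aˣ) : A))
    (up1 : ℤ_[p]ˣ) (hup1 : ((up1 : ℤ_[p]) : ℚ_[p]) = 1 + (p : ℚ_[p]))
    (hχnorm : ‖((χ up1 : Aˣ) : A) - 1‖ <
      (p : ℝ) ^ (-(1 / ((p : ℝ) ^ s * ((p : ℝ) - 1))) : ℝ))
    -- `C = A ⊗̂ B`, presented by isometric embeddings with dense product span: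
    (C : Type*) [NormedCommRing C] [NormedAlgebra ℚ_[p] C] [CompleteSpace C]
    [IsUltrametricDist C]
    (ιA : A →ₐ[ℚ_[p]] C) (ιB : B →ₐ[ℚ_[p]] C)
    (hιA : ∀ a : A, ‖ιA a‖ = ‖a‖) (hιB : ∀ b : B, ‖ιB b‖ = ‖b‖)
    (hdense : Dense (↑(Submodule.span ℚ_[p]
      (Set.range fun x : A × B => ιA x.1 * ιB x.2)) : Set C)) :
    ∃ F : B → C,
      -- the series converges to `F b` for every `b = ω·u` with `ω^{p-1} = 1` and
      -- `u = 1 + p·t + b₀ ∈ 1 + pℤ_p + p^{s+1}B°`: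
      (∀ (ω : ℤ_[p]ˣ), ω ^ (p - 1) = 1 →
        ∀ (t : ℤ_[p]) (b₀ : B), ‖b₀‖ ≤ (p : ℝ) ^ (-(s + 1 : ℤ)) →
          HasSum
            (fun j : ℕ =>
              ιA (((χ ω : Aˣ) : A) * (((χ up1 : Aˣ) : A) - 1) ^ j) *
                ιB (binomCoeff p B
                  ((plog p ℚ_[p] (1 + (p : ℚ_[p])))⁻¹ •
                    plog p B (1 + algebraMap ℚ_[p] B ((p : ℚ_[p]) * (t : ℚ_[p])) + b₀)) j))
            (F (algebraMap ℚ_[p] B (((ω : ℤ_[p]) : ℚ_[p])) *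
              (1 + algebraMap ℚ_[p] B ((p : ℚ_[p]) * (t : ℚ_[p])) + b₀)))) ∧
      -- the values lie in the unit ball `A° ⊗̂_{ℤ_p} B°` of `C`:
      (∀ b ∈ BsSet p s B, ‖F b‖ ≤ 1) ∧
      -- `F` is a group homomorphism on `B_s^×` (in particular its values are units):
      (∀ b₁ ∈ BsSet p s B, ∀ b₂ ∈ BsSet p s B, F (b₁ * b₂) = F b₁ * F b₂) ∧
      F 1 = 1 ∧
      -- `F` extends `χ` on `ℤ_p^×`:
      (∀ z : ℤ_[p]ˣ, F (algebraMap ℚ_[p] B (((z : ℤ_[p]) : ℚ_[p]))) = ιA ((χ z : Aˣ) : A)) ∧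
      -- `F` is continuous on `B_s^×`:
      ContinuousOn F (BsSet p s B) := by
  classical
  have : NormOneClass A := ⟨by simpa using huA 0 0⟩
  have : NormOneClass B := ⟨by simpa using huB 0 0⟩
  have : NormOneClass C := ⟨by rw [← map_one ιA, hιA, norm_one]⟩
  have hp0 : (0 : ℝ) < p := by exact_mod_cast (Fact.out : p.Prime).pos
  have hιAc : Continuous ιA := (AddMonoidHomClass.isometry_of_norm ιA hιA).continuous
  let ψ : ℤ_[p]ˣ →* C := (ιA : A →* C).comp ((Units.coeHom A).comp χ)
  have hψ : ∀ z, ψ z = ιA (χ z : Aˣ) := fun z => rfl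
  have hψc : Continuous ψ := hιAc.comp hχcont
  have hτ : ‖ψ up1 - 1‖ * PadicBanach.binomGrowth p s < 1 := by
    have h1 : ‖ψ up1 - 1‖ = ‖((χ up1 : Aˣ) : A) - 1‖ := by
      rw [hψ, ← map_one ιA, ← map_sub, hιA]
    have h2 : 0 < PadicBanach.binomGrowth p s :=
      zero_lt_one.trans_le (PadicBanach.one_le_binomGrowth s)
    rw [Real.rpow_neg hp0.le] at hχnorm
    rw [h1, ← lt_div_iff₀ h2, one_div]
    exact hχnorm
  let G : B → C := fun u => PadicBanach.binomSeries ιB (ψ up1 - 1) (PadicBanach.logRatio p B u)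
  have hdom : ∀ u ∈ PadicBanach.oneUnits p s B,
      PadicBanach.logRatio p B u ∈ PadicBanach.binomDomain p s B :=
    fun u hu => PadicBanach.logRatio_mem_binomDomain hp hu
  have hGmul : ∀ u ∈ PadicBanach.oneUnits p s B, ∀ v ∈ PadicBanach.oneUnits p s B,
      G (u * v) = G u * G v := by
    intro u hu v hv
    simp only [G]
    rw [PadicBanach.logRatio_mul hu hv, PadicBanach.binomSeries_add hιB hτ (hdom u hu) (hdom v hv)]
  have hGcont : ContinuousOn G (PadicBanach.oneUnits p s B) :=
    (PadicBanach.continuousOn_binomSeries hιB hτ).comp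
      ((PadicBanach.continuousOn_logRatio (by positivity) PadicBanach.inv_p_lt_one).mono
        fun u hu => PadicBanach.norm_sub_one_of_mem_oneUnits hu) hdom
  obtain ⟨F, hF⟩ : ∃ F : B → C, ∀ ω : ℤ_[p]ˣ, ω ^ (p - 1) = 1 →
      ∀ u ∈ PadicBanach.oneUnits p s B,
        F (algebraMap ℚ_[p] B ((ω : ℤ_[p]) : ℚ_[p]) * u) = ψ ω * G u := by
    let P : B → ℤ_[p]ˣ × B → Prop := fun b x => x.1 ^ (p - 1) = 1 ∧
      x.2 ∈ PadicBanach.oneUnits p s B ∧ b = algebraMap ℚ_[p] B ((x.1 : ℤ_[p]) : ℚ_[p]) * x.2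
    refine ⟨fun b => if h : ∃ x, P b x then ψ h.choose.1 * G h.choose.2 else 0, ?_⟩
    intro ω hω u hu
    have h : ∃ x, P (algebraMap ℚ_[p] B ((ω : ℤ_[p]) : ℚ_[p]) * u) x := ⟨(ω, u), hω, hu, rfl⟩
    obtain ⟨h1, h2, h3⟩ := h.choose_spec
    have hωω : h.choose.1 = ω := by
      refine PadicBanach.eq_of_norm_sub_lt_one hp h1 hω h2 hu ?_
      rw [← h3, sub_self, norm_zero]
      exact one_pos
    have hunit : IsUnit (algebraMap ℚ_[p] B ((ω : ℤ_[p]) : ℚ_[p])) :=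
      (ω.isUnit.map PadicInt.Coe.ringHom).map (algebraMap ℚ_[p] B)
    have huu : h.choose.2 = u := by
      rw [hωω] at h3
      exact (hunit.mul_left_cancel h3).symm
    simp only
    rw [dif_pos h, hωω, huu]
  have hFψ : ∀ z : ℤ_[p]ˣ,
      F (algebraMap ℚ_[p] B (((z : ℤ_[p]) : ℚ_[p]))) = ιA ((χ z : Aˣ) : A) := by
    intro z
    obtain ⟨ω, hω, hzω⟩ := PadicBanach.exists_teichmuller z
    have hv : ‖((ω⁻¹ * z : ℤ_[p]ˣ) : ℤ_[p]) - 1‖ < 1 := by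
      have : ((ω⁻¹ * z : ℤ_[p]ˣ) : ℤ_[p]) - 1 =
          ((ω⁻¹ : ℤ_[p]ˣ) : ℤ_[p]) * ((z : ℤ_[p]) - ω) := by
        rw [mul_sub, Units.inv_mul, Units.val_mul]
      rwa [this, norm_mul, PadicInt.norm_units, one_mul]
    have hz : z = ω * (ω⁻¹ * z) := (mul_inv_cancel_left ω z).symm
    have h1 := hF ω hω _ (PadicBanach.unit_mem_oneUnits s hv)
    rw [← map_mul, ← PadicInt.coe_mul, ← Units.val_mul, ← hz] at h1
    simp only [G] at h1
    rw [h1, PadicBanach.binomSeries_logRatio_unit hιB hp ψ hψc hup1 hτ hv, ← map_mul, ← hz, hψ]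
  refine ⟨F, ?_, ?_, ?_, ?_, hFψ, ?_⟩
  · intro ω hω t b₀ hb₀
    have hu : 1 + algebraMap ℚ_[p] B ((p : ℚ_[p]) * (t : ℚ_[p])) + b₀ ∈
        PadicBanach.oneUnits p s B := ⟨t, b₀, hb₀, rfl⟩
    rw [hF ω hω _ hu]
    refine ((PadicBanach.hasSum_binomSeries hιB hτ (hdom _ hu)).mul_left (ψ ω)).congr_fun ?_
    intro j
    rw [hψ, hψ, map_mul, map_pow, map_sub, map_one, mul_assoc]
    rfl
  · intro b hb
    obtain ⟨ω, hω, u, hu, rfl⟩ := PadicBanach.exists_decomposition_of_mem_BsSet hb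
    rw [hF ω hω u hu]
    have h1 : ‖ψ ω‖ = 1 := by
      have h2 : ‖((χ ω : Aˣ) : A)‖ ^ (p - 1) = 1 := by
        rw [← huA, ← Units.val_pow_eq_pow_val, ← map_pow, hω, map_one, Units.val_one, norm_one]
      rw [hψ, hιA]
      refine (pow_eq_one_iff_of_nonneg (norm_nonneg _) ?_).1 h2
      have := (Fact.out : p.Prime).two_le
      omega
    refine (norm_mul_le _ _).trans ?_
    rw [h1, one_mul]
    exact PadicBanach.norm_binomSeries_le hιB hτ (hdom u hu)
  · intro b₁ hb₁ b₂ hb₂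
    obtain ⟨ω₁, hω₁, u₁, hu₁, rfl⟩ := PadicBanach.exists_decomposition_of_mem_BsSet hb₁
    obtain ⟨ω₂, hω₂, u₂, hu₂, rfl⟩ := PadicBanach.exists_decomposition_of_mem_BsSet hb₂
    have h := hF (ω₁ * ω₂) (by rw [mul_pow, hω₁, hω₂, one_mul]) _
      (PadicBanach.oneUnits_mul hu₁ hu₂)
    rw [Units.val_mul, PadicInt.coe_mul, map_mul, mul_mul_mul_comm] at h
    rw [h, hF ω₁ hω₁ u₁ hu₁, hF ω₂ hω₂ u₂ hu₂, hGmul u₁ hu₁ u₂ hu₂, map_mul, mul_mul_mul_comm]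
  · simpa using hFψ 1
  · intro b hb
    rw [← continuousWithinAt_inter (Metric.ball_mem_nhds b one_pos)]
    obtain ⟨ω, hω, u, hu, rfl⟩ := PadicBanach.exists_decomposition_of_mem_BsSet hb
    set b := algebraMap ℚ_[p] B ((ω : ℤ_[p]) : ℚ_[p]) * u
    set β := algebraMap ℚ_[p] B (((ω⁻¹ : ℤ_[p]ˣ) : ℤ_[p]) : ℚ_[p])
    have hβ : ∀ x : B, β * (algebraMap ℚ_[p] B ((ω : ℤ_[p]) : ℚ_[p]) * x) = x := by
      intro x
      rw [← mul_assoc, ← map_mul, ← PadicInt.coe_mul, Units.inv_mul, PadicInt.coe_one, map_one,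
        one_mul]
    have hdec : ∀ x ∈ BsSet p s B ∩ Metric.ball b 1, ∃ w ∈ PadicBanach.oneUnits p s B,
        x = algebraMap ℚ_[p] B ((ω : ℤ_[p]) : ℚ_[p]) * w := by
      rintro x ⟨hx, hxb⟩
      obtain ⟨ω', hω', w, hw, rfl⟩ := PadicBanach.exists_decomposition_of_mem_BsSet hx
      rw [mem_ball_iff_norm] at hxb
      rw [PadicBanach.eq_of_norm_sub_lt_one hp hω' hω hw hu hxb]
      exact ⟨w, hw, rfl⟩
    have hcont : ContinuousOn (fun x => ψ ω * G (β * x)) (BsSet p s B ∩ Metric.ball b 1) := by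
      refine continuousOn_const.mul (hGcont.comp (by fun_prop) fun x hx => ?_)
      obtain ⟨w, hw, rfl⟩ := hdec x hx
      rwa [hβ]
    refine (hcont.congr fun x hx => ?_) b ⟨hb, Metric.mem_ball_self one_pos⟩
    obtain ⟨w, hw, rfl⟩ := hdec x hx
    rw [hF ω hω w hw, hβ]
end

section
/- Let B be a ring with a left action of a finite group G, and set A = B^G. Let q ∈ Spec B with p = q ∩ A. Then: (a) G acts transitively on the set of primes of B lying over p; (b) Frac(B/q) is a normal extension of Frac(A/p) and the stabilizer G_q surjects onto Aut(Frac(B/q)/Frac(A/p)); consequently G_q acts transitively on the valuations on Frac(B/q) extending a fixed valuation on Frac(A/p). -/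
/-!
STATEMENT 8: Let `B` be a (commutative) ring with a left action of a finite group `G`, and set
`A = B^G`.  Let `q ∈ Spec B` with `p = q ∩ A`.  Then:
(a) `G` acts transitively on the set of primes of `B` lying over `p`;
(b) `Frac(B/q)` is a normal extension of `Frac(A/p)` and the stabilizer `G_q` surjects onto
`Aut(Frac(B/q)/Frac(A/p))`; consequently `G_q` acts transitively on the valuations on
`Frac(B/q)` extending a fixed valuation on `Frac(A/p)`.

(Bourbaki, Commutative Algebra V.2.2 Theorem 2 (i), (ii), combined with Zariski–Samuel VI.7
Corollary 3.  `B` is automatically integral over `A = B^G`.)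

Since `Frac(B/q)` is generated as a field over `Frac(A/p)` by the image of `B`, a field
endomorphism over `Frac(A/p)` (resp. a valuation, resp. an equivalence of valuations) is
determined by its effect on the image of `B` (resp. on pairs of elements of the image of `B`);
the surjectivity and transitivity statements are phrased accordingly.
-/

/-- The fixed subring `A = B^G`. -/
def fixedSubring (G : Type*) (B : Type*) [Group G] [CommRing B] [MulSemiringAction G B] :
    Subring B where
  carrier := {b | ∀ g : G, g • b = b}
  zero_mem' := fun g => smul_zero g
  one_mem' := fun g => smul_one g
  add_mem' := fun ha hb g => by rw [smul_add, ha g, hb g]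
  mul_mem' := fun ha hb g => by rw [smul_mul', ha g, hb g]
  neg_mem' := fun ha g => by rw [smul_neg, ha g]

variable (G B : Type) [Group G] [Finite G] [CommRing B] [MulSemiringAction G B]

/-- The prime `p = q ∩ A` of `A = B^G` under `q`. -/
def underPrime (q : Ideal B) : Ideal (fixedSubring G B) :=
  Ideal.comap (fixedSubring G B).subtype q

/-- The induced embedding `A/p → B/q`. -/
def resQuot (q : Ideal B) : (fixedSubring G B) ⧸ underPrime G B q →+* B ⧸ q :=
  Ideal.quotientMap q (fixedSubring G B).subtype le_rfl

/-- The induced map `A/p → Frac(B/q)`. -/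
noncomputable def toFracBq (q : Ideal B) :
    (fixedSubring G B) ⧸ underPrime G B q →+* FractionRing (B ⧸ q) :=
  (algebraMap (B ⧸ q) (FractionRing (B ⧸ q))).comp (resQuot G B q)

/-- The canonical map `B → Frac(B/q)`. -/
noncomputable def ιB (q : Ideal B) : B → FractionRing (B ⧸ q) :=
  fun b => algebraMap (B ⧸ q) (FractionRing (B ⧸ q)) (Ideal.Quotient.mk q b)

/-- The structure of `Frac(A/p)`-algebra on `Frac(B/q)`. -/
noncomputable def fracAlgebra (q : Ideal B) [q.IsPrime] :
    Algebra (FractionRing ((fixedSubring G B) ⧸ underPrime G B q)) (FractionRing (B ⧸ q)) := by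
  haveI : (underPrime G B q).IsPrime := Ideal.IsPrime.comap _
  refine RingHom.toAlgebra (IsFractionRing.lift (g := toFracBq G B q) ?_)
  have h1 : Function.Injective (resQuot G B q) := Ideal.quotientMap_injective
  have h2 : Function.Injective (algebraMap (B ⧸ q) (FractionRing (B ⧸ q))) :=
    IsFractionRing.injective _ _
  exact h2.comp h1

open Polynomial in
/-- Any element of a valuation subring `V` of an algebraic extension `L` of `K` is a quotient with
denominator a unit of `V`, where numerator and denominator lie in every valuation subring of `L`
containing `V ∩ K`. -/
theorem ValuationSubring.exists_valuation_eq_one_and_mul_mem {K L : Type*} [Field K] [Field L]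
    [Algebra K L] (V : ValuationSubring L) {x : L} (hx : x ∈ V) (halg : IsAlgebraic K x) :
    ∃ s : L, V.valuation s = 1 ∧ ∀ U : ValuationSubring L,
      V.comap (algebraMap K L) ≤ U.comap (algebraMap K L) → s ∈ U ∧ s * x ∈ U := by
  obtain ⟨p, hp0, hp⟩ := halg
  obtain ⟨j, hj, hmax⟩ := p.support.exists_max_image
    (fun i ↦ V.valuation (algebraMap K L (p.coeff i))) (support_nonempty.mpr hp0)
  have hj0 : p.coeff j ≠ 0 := mem_support_iff.mp hj
  have hjL : algebraMap K L (p.coeff j) ≠ 0 := by simpa using hj0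
  have hjv : V.valuation (algebraMap K L (p.coeff j)) ≠ 0 := by simpa using hj0
  let f : K[X] := C (p.coeff j)⁻¹ * p
  have hfx : aeval x f = 0 := by simp [f, hp]
  have hfV (i : ℕ) : algebraMap K L (f.coeff i) ∈ V := by
    rw [← V.valuation_le_one_iff]
    by_cases hi : p.coeff i = 0
    · simp [f, hi]
    · have := hmax i (mem_support_iff.mpr hi)
      simp only [f, coeff_C_mul, map_mul, map_inv₀]
      rw [mul_comm, ← div_eq_mul_inv]
      exact div_le_one_of_le₀ this zero_le
  have hfj : V.valuation (algebraMap K L (f.coeff j)) = 1 := by simp [f, hj0]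
  let b (i : ℕ) : L := aeval x (divX^[i] f)
  have hcoeff (i n : ℕ) : (divX^[i] f).coeff n = f.coeff (n + i) := by
    induction i generalizing n with
    | zero => rfl
    | succ i ih => rw [Function.iterate_succ_apply', coeff_divX, ih]; congr 1; ring
  have hb (i : ℕ) : b i = b (i + 1) * x + algebraMap K L (f.coeff i) := by
    have := congrArg (aeval x) (divX_mul_X_add (divX^[i] f))
    rw [hcoeff, zero_add] at this
    simpa [b, Function.iterate_succ_apply'] using this.symm
  have hmem (U : ValuationSubring L)
      (hU : V.comap (algebraMap K L) ≤ U.comap (algebraMap K L)) (i : ℕ) :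
      b i ∈ U ∧ b i * x ∈ U := by
    have hfU (i : ℕ) : algebraMap K L (f.coeff i) ∈ U := hU (hfV i)
    rcases U.mem_or_inv_mem x with hxU | hxU
    · have : b i ∈ U := by
        simp only [b, aeval_eq_sum_range, hcoeff, Algebra.smul_def]
        exact sum_mem fun n _ ↦ U.mul_mem _ _ (hfU _) (pow_mem hxU n)
      exact ⟨this, U.mul_mem _ _ this hxU⟩
    · rcases eq_or_ne x 0 with rfl | hx0
      · have hbi := hb i
        rw [mul_zero, zero_add] at hbi
        simpa [hbi] using hfU i
      have hstep (i : ℕ) (h : b i ∈ U) : b (i + 1) * x ∈ U := by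
        rw [← sub_eq_iff_eq_add.mpr (hb i)]
        exact sub_mem h (hfU i)
      have hbU (i : ℕ) : b i ∈ U := by
        induction i with
        | zero => simp [b, hfx]
        | succ i ih => simpa [mul_assoc, hx0] using U.mul_mem _ _ (hstep i ih) hxU
      refine ⟨hbU i, ?_⟩
      cases i with
      | zero => simp [b, hfx]
      | succ i => exact hstep i (hbU i)
  have hvx := (V.valuation_le_one_iff x).mpr hx
  have hvb (i : ℕ) := (V.valuation_le_one_iff (b i)).mpr (hmem V le_rfl i).1
  by_cases h : V.valuation (b j) = 1
  · exact ⟨b j, h, fun U hU ↦ hmem U hU j⟩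
  refine ⟨b (j + 1), (hvb _).antisymm ?_, fun U hU ↦ hmem U hU (j + 1)⟩
  by_contra! hlt
  have h1 : V.valuation (b (j + 1) * x) < 1 := by
    rw [map_mul]
    exact mul_lt_one_of_lt_of_le hlt hvx
  have h2 := V.valuation.map_sub_lt (lt_of_le_of_ne (hvb j) h) h1
  rw [hb j, add_sub_cancel_left, hfj] at h2
  exact lt_irrefl _ h2

/-- In a normal extension, some power of an element fixed by all automorphisms lies in the base
field. -/
theorem Normal.exists_algebraMap_eq_pow {K L : Type*} [Field K] [Field L] [Algebra K L]
    [Normal K L] {x : L} (hx : ∀ σ : Gal(L/K), σ x = x) :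
    ∃ n : ℕ, n ≠ 0 ∧ ∃ k : K, algebraMap K L k = x ^ n := by
  have hint := Normal.isIntegral (F := K) inferInstance x
  have hroots : ∀ y ∈ ((minpoly K x).map (algebraMap K L)).roots, y = x := fun y hy ↦ by
    have hy' : Polynomial.aeval y (minpoly K x) = 0 := by
      simpa [Polynomial.aeval_def, Polynomial.eval_map] using (Polynomial.mem_roots'.mp hy).2
    obtain ⟨σ, hσ⟩ := minpoly.exists_algEquiv_of_root hint.isAlgebraic hy'
    exact ((hx σ.symm).symm.trans (σ.symm_apply_eq.mpr hσ.symm)).symm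
  have hsplit := Normal.splits (F := K) inferInstance x
  have hcoeff := hsplit.coeff_zero_eq_prod_roots_of_monic
    ((minpoly.monic hint).map (algebraMap K L))
  rw [Multiset.eq_replicate_card.mpr hroots, Multiset.prod_replicate,
    ← hsplit.natDegree_eq_card_roots, Polynomial.natDegree_map, Polynomial.coeff_map] at hcoeff
  refine ⟨_, (minpoly.natDegree_pos hint).ne', (-1) ^ (minpoly K x).natDegree *
    (minpoly K x).coeff 0, ?_⟩
  rw [map_mul, hcoeff, ← mul_assoc]
  simp [← mul_pow]

/-- Membership in the maximal ideal of a valuation subring, for elements of a subfield, depends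
only on the trace of the valuation subring on the subfield. -/
theorem ValuationSubring.valuation_algebraMap_lt_one_iff {K L : Type*} [Field K] [Field L]
    [Algebra K L] {V W : ValuationSubring L}
    (h : V.comap (algebraMap K L) = W.comap (algebraMap K L)) (k : K) :
    V.valuation (algebraMap K L k) < 1 ↔ W.valuation (algebraMap K L k) < 1 := by
  have := SetLike.ext_iff.mp h k⁻¹
  simp only [mem_comap, map_inv₀] at this
  rw [← mem_nonunits_iff, ← mem_nonunits_iff, mem_nonunits_iff_or, mem_nonunits_iff_or, this]

/-- Two valuation subrings of a normal extension with the same trace on the base field are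
comparable up to an automorphism. -/
theorem ValuationSubring.exists_algEquiv_forall_mem_of_comap_eq {K L : Type*} [Field K] [Field L]
    [Algebra K L] [Normal K L] [Finite Gal(L/K)] {V W : ValuationSubring L}
    (h : V.comap (algebraMap K L) = W.comap (algebraMap K L)) :
    ∃ σ : Gal(L/K), ∀ x, σ x ∈ V → x ∈ W := by
  classical
  cases nonempty_fintype Gal(L/K)
  let S : Set (ValuationSubring L) :=
    {U | V.comap (algebraMap K L) ≤ U.comap (algebraMap K L)}
  let C : Subring L := ⨅ U : S, U.1.toSubring
  have mem_C (x : L) : x ∈ C ↔ ∀ U ∈ S, x ∈ U := by simp [C, Subring.mem_iInf]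
  have smul_C (σ : Gal(L/K)) {x : L} (hx : x ∈ C) : σ x ∈ C := by
    rw [mem_C] at hx ⊢
    intro U hU
    refine hx (U.comap (σ : L →+* L)) fun k hk ↦ ?_
    simpa [mem_comap] using hU hk
  have C_le_V {x : L} (hx : x ∈ C) : x ∈ V :=
    (mem_C x).mp hx V (le_refl (V.comap (algebraMap K L)))
  have C_le_W {x : L} (hx : x ∈ C) : x ∈ W := (mem_C x).mp hx W h.le
  let φ (σ : Gal(L/K)) : C →+* V :=
    ((σ : L →+* L).comp C.subtype).codRestrict V.toSubring fun c ↦ C_le_V (smul_C σ c.2)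
  let ψ : C →+* W := C.subtype.codRestrict W.toSubring fun c ↦ C_le_W c.2
  have mem_φ (σ : Gal(L/K)) (c : C) :
      c ∈ (IsLocalRing.maximalIdeal V).comap (φ σ) ↔ V.valuation (σ c) < 1 :=
    Ideal.mem_comap.trans (V.valuation_lt_one_iff _)
  have mem_ψ (c : C) : c ∈ (IsLocalRing.maximalIdeal W).comap ψ ↔ W.valuation c < 1 :=
    Ideal.mem_comap.trans (W.valuation_lt_one_iff _)
  obtain ⟨σ, -, hσ⟩ := (Ideal.subset_union_prime (s := Finset.univ)
    (f := fun σ ↦ (IsLocalRing.maximalIdeal V).comap (φ σ))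
    (I := (IsLocalRing.maximalIdeal W).comap ψ) 1 1
    (fun σ _ _ _ ↦ Ideal.IsPrime.comap _)).mp fun c hc ↦ by
      replace hc := (mem_ψ c).mp hc
      suffices ∃ σ : Gal(L/K), V.valuation (σ c) < 1 by
        obtain ⟨σ, hσ⟩ := this
        exact Set.mem_biUnion (Finset.mem_coe.mpr (Finset.mem_univ σ)) ((mem_φ σ c).mpr hσ)
      by_contra! hV
      obtain ⟨n, hn, k, hk⟩ := Normal.exists_algebraMap_eq_pow (K := K)
        (x := ∏ σ : Gal(L/K), σ (c : L)) fun τ ↦ by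
          rw [map_prod]
          exact Fintype.prod_equiv (Equiv.mulLeft τ) _ _ fun σ ↦ rfl
      have hWk : W.valuation (algebraMap K L k) < 1 := by
        rw [hk, map_pow, map_prod]
        refine pow_lt_one₀ zero_le ?_ hn
        rw [← Finset.mul_prod_erase _ _ (Finset.mem_univ (1 : Gal(L/K)))]
        exact mul_lt_one_of_lt_of_le hc (Finset.prod_le_one' fun σ _ ↦
          (W.valuation_le_one_iff _).mpr (C_le_W (smul_C σ c.2)))
      rw [← valuation_algebraMap_lt_one_iff h, hk, map_pow, map_prod] at hWk
      exact hWk.not_ge (one_le_pow₀ (Finset.one_le_prod' fun σ _ ↦ hV σ))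
  refine ⟨σ, fun x hx ↦ ?_⟩
  obtain ⟨s, hs, hsC⟩ := V.exists_valuation_eq_one_and_mul_mem (K := K) hx
    (Algebra.IsAlgebraic.isAlgebraic _)
  have h₁ : σ.symm s ∈ C := smul_C σ.symm ((mem_C s).mpr fun U hU ↦ (hsC U hU).1)
  have h₂ : σ.symm s * x ∈ C := by
    simpa using smul_C σ.symm ((mem_C (s * σ x)).mpr fun U hU ↦ (hsC U hU).2)
  have h₃ : W.valuation (σ.symm s) = 1 := by
    refine ((W.valuation_le_one_iff _).mpr (C_le_W h₁)).antisymm (not_lt.mp fun hlt ↦ ?_)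
    have := (mem_φ σ ⟨_, h₁⟩).mp (hσ ((mem_ψ ⟨_, h₁⟩).mpr hlt))
    simp [hs] at this
  have hx := (W.valuation_le_one_iff _).mpr (C_le_W h₂)
  rwa [map_mul, h₃, one_mul, W.valuation_le_one_iff] at hx

/-- Valuation subrings of a normal extension with the same trace on the base field are conjugate
under the automorphism group. -/
theorem ValuationSubring.exists_algEquiv_mem_iff_of_comap_eq {K L : Type*} [Field K] [Field L]
    [Algebra K L] [Normal K L] [Finite Gal(L/K)] {V W : ValuationSubring L}
    (h : V.comap (algebraMap K L) = W.comap (algebraMap K L)) :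
    ∃ σ : Gal(L/K), ∀ x, x ∈ W ↔ σ x ∈ V := by
  obtain ⟨σ, hσ⟩ := exists_algEquiv_forall_mem_of_comap_eq h
  obtain ⟨τ, hτ⟩ := exists_algEquiv_forall_mem_of_comap_eq h.symm
  refine ⟨σ, fun x ↦ ⟨fun hx ↦ ?_, hσ x⟩⟩
  have hiter (n : ℕ) : ∀ y, ((τ * σ) ^ n) y ∈ W → y ∈ W := by
    induction n with
    | zero => exact fun y hy ↦ hy
    | succ n ih => exact fun y hy ↦ hσ _ (hτ _ (ih _ (by simpa [pow_succ] using hy)))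
  apply hτ
  refine hiter (orderOf (τ * σ) - 1) _ ?_
  have hpow : (τ * σ) ^ (orderOf (τ * σ) - 1) * (τ * σ) = 1 := by
    rw [← pow_succ, Nat.sub_add_cancel (orderOf_pos _), pow_orderOf_eq_one]
  have := DFunLike.congr_fun hpow x
  rw [AlgEquiv.mul_apply, AlgEquiv.mul_apply, AlgEquiv.one_apply] at this
  rwa [this]

instance fixedSubring.isInvariant (G B : Type*) [Group G] [CommRing B] [MulSemiringAction G B] :
    Algebra.IsInvariant (fixedSubring G B) B G :=
  ⟨fun b hb ↦ ⟨⟨b, hb⟩, rfl⟩⟩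

instance fixedSubring.smulCommClass (G B : Type*) [Group G] [CommRing B]
    [MulSemiringAction G B] : SMulCommClass G (fixedSubring G B) B where
  smul_comm g a b := by
    rw [Subring.smul_def, Subring.smul_def, smul_eq_mul, smul_eq_mul, smul_mul', a.2 g]

theorem fixed_subring_primes_transitive_and_normal
    (q : Ideal B) [hq : q.IsPrime] :
    -- (a) transitivity of `G` on primes over `p = q ∩ A`:
    (∀ q' : Ideal B, q'.IsPrime →
      Ideal.comap (fixedSubring G B).subtype q' = underPrime G B q →
        ∃ g : G, q' = Ideal.comap (MulSemiringAction.toRingHom G B g) q) ∧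
    -- (b) `Frac(B/q)/Frac(A/p)` is normal ...
    (letI : (underPrime G B q).IsPrime := Ideal.IsPrime.comap _
     letI := fracAlgebra G B q
     Normal (FractionRing ((fixedSubring G B) ⧸ underPrime G B q)) (FractionRing (B ⧸ q))) ∧
    -- ... and every `Frac(A/p)`-algebra endomorphism of `Frac(B/q)` (i.e. every ring
    -- endomorphism fixing the image of `A`) is induced by an element of the stabilizer `G_q`:
    (∀ σ : FractionRing (B ⧸ q) →+* FractionRing (B ⧸ q),
      (∀ a : fixedSubring G B, σ (ιB B q (a : B)) = ιB B q (a : B)) →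
        ∃ g : G, (∀ b : B, b ∈ q ↔ g • b ∈ q) ∧
          ∀ b : B, σ (ιB B q b) = ιB B q (g • b)) ∧
    -- consequently `G_q` acts transitively on the (equivalence classes of) valuations on
    -- `Frac(B/q)` extending a fixed valuation on `Frac(A/p)`:
    (∀ (Γ₁ Γ₂ : Type) (_ : LinearOrderedCommGroupWithZero Γ₁)
        (_ : LinearOrderedCommGroupWithZero Γ₂)
        (v : Valuation (FractionRing (B ⧸ q)) Γ₁)
        (w : Valuation (FractionRing (B ⧸ q)) Γ₂),
      -- `v` and `w` restrict to equivalent valuations on `Frac(A/p)`: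
      (∀ a a' : fixedSubring G B,
        v (ιB B q (a : B)) ≤ v (ιB B q (a' : B)) ↔
          w (ιB B q (a : B)) ≤ w (ιB B q (a' : B))) →
        ∃ g : G, (∀ b : B, b ∈ q ↔ g • b ∈ q) ∧
          ∀ b b' : B, w (ιB B q b) ≤ w (ιB B q b') ↔
            v (ιB B q (g • b)) ≤ v (ιB B q (g • b'))) := by
  let : (underPrime G B q).IsPrime := Ideal.IsPrime.comap _
  let := fracAlgebra G B q
  have : q.LiesOver (underPrime G B q) := ⟨rfl⟩
  let K := FractionRing ((fixedSubring G B) ⧸ underPrime G B q)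
  let L := FractionRing (B ⧸ q)
  have : IsScalarTower ((fixedSubring G B) ⧸ underPrime G B q) K L :=
    .of_algebraMap_eq fun x ↦ (IsFractionRing.lift_algebraMap (g := toFracBq G B q) _ x).symm
  have normal : Normal K L := Ideal.IsFractionRing.normal G (underPrime G B q) q K L
  have hsurj := IsFractionRing.stabilizerHom_surjective G (underPrime G B q) q K L
  have : Finite Gal(L/K) := Finite.of_surjective _ hsurj
  have lift_aut (σ : Gal(L/K)) : ∃ g : G, (∀ b : B, b ∈ q ↔ g • b ∈ q) ∧
      ∀ b : B, σ (ιB B q b) = ιB B q (g • b) := by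
    obtain ⟨g, rfl⟩ := hsurj σ
    refine ⟨g, fun b ↦ ?_, fun b ↦ IsFractionRing.stabilizerHom_apply_apply_mk G _ q K L g b⟩
    open scoped Pointwise in
    rw [← Ideal.smul_mem_pointwise_smul_iff (a := (g : G)), MulAction.mem_stabilizer_iff.mp g.2]
  have exists_div (k : K) : ∃ a a' : fixedSubring G B, ιB B q a' ≠ 0 ∧
      algebraMap K L k = ιB B q a / ιB B q a' := by
    have hι (a : fixedSubring G B) : algebraMap K L (algebraMap _ K
        (Ideal.Quotient.mk (underPrime G B q) a)) = ιB B q a :=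
      (IsScalarTower.algebraMap_apply _ K L _).symm
    obtain ⟨x, y, hy, rfl⟩ := IsFractionRing.div_surjective
      ((fixedSubring G B) ⧸ underPrime G B q) k
    obtain ⟨a, rfl⟩ := Ideal.Quotient.mk_surjective x
    obtain ⟨a', rfl⟩ := Ideal.Quotient.mk_surjective y
    refine ⟨a, a', ?_, by rw [map_div₀, hι, hι]⟩
    rw [← hι, Ne, map_eq_zero, IsFractionRing.to_map_eq_zero_iff]
    exact nonZeroDivisors.ne_zero hy
  refine ⟨fun q' hq' h ↦ ?_, normal, fun σ hσ ↦ ?_, fun Γ₁ Γ₂ _ _ v w hvw ↦ ?_⟩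
  · obtain ⟨g, rfl⟩ := Algebra.IsInvariant.exists_smul_of_under_eq
      (fixedSubring G B) B G q q' h.symm
    exact ⟨g⁻¹, Ideal.ext fun b ↦ Ideal.mem_pointwise_smul_iff_inv_smul_mem⟩
  · let φ : L →ₐ[K] L :=
      { σ with
        commutes' := fun k ↦ by
          obtain ⟨a, a', -, hk⟩ := exists_div k
          change σ _ = _
          rw [hk, map_div₀, hσ, hσ] }
    exact lift_aut (AlgEquiv.ofBijective φ (AlgHom.normal_bijective K L L φ))
  · have hcomap : v.valuationSubring.comap (algebraMap K L) =
        w.valuationSubring.comap (algebraMap K L) := by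
      ext k
      obtain ⟨a, a', ha', hk⟩ := exists_div k
      have hv : 0 < v (ιB B q a') := by simpa [zero_lt_iff] using ha'
      have hw : 0 < w (ιB B q a') := by simpa [zero_lt_iff] using ha'
      simp only [ValuationSubring.mem_comap, Valuation.mem_valuationSubring_iff, hk, map_div₀]
      rw [div_le_one₀ hv, div_le_one₀ hw, hvw]
    obtain ⟨σ, hσ⟩ := ValuationSubring.exists_algEquiv_mem_iff_of_comap_eq hcomap
    have hequiv : w.IsEquiv (v.comap (σ : L →+* L)) :=
      Valuation.isEquiv_of_val_le_one fun {x} ↦ hσ x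
    obtain ⟨g, hg, hgσ⟩ := lift_aut σ
    refine ⟨g, hg, fun b b' ↦ ?_⟩
    rw [← hgσ, ← hgσ]
    exact hequiv _ _
end
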